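/- The map (q₀,q₁) ↦ dim_H 𝒰_{q₀,q₁} is continuous on (1,∞) × (1,∞). -/

import Mathlib

open Filter Topology

/-- The base corresponding to a digit: `q0` for digit `0` (`false`), `q1` for digit `1` (`true`). -/
noncomputable def qb (q0 q1 : ℝ) (d : Bool) : ℝ := if d then q1 else q0

/-- `piE q0 q1 i = Σ_{k=1}^∞ i_k / (q_{i_1} ⋯ q_{i_k})`, with 0-based indexing. -/
noncomputable def piE (q0 q1 : ℝ) (i : ℕ → Bool) : ℝ :=
  ∑' k : ℕ, (if i k then (1 : ℝ) else 0) / ∏ j ∈ Finset.range (k + 1), qb q0 q1 (i j)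

/-- Strict lexicographic order `≺` on binary sequences. -/
def lexLt (u v : ℕ → Bool) : Prop := ∃ n : ℕ, (∀ m, m < n → u m = v m) ∧ u n < v n

/-- Non-strict lexicographic order `⪯`. -/
def lexLe (u v : ℕ → Bool) : Prop := lexLt u v ∨ u = v

/-- The tail `i_{n+1} i_{n+2} ⋯` of a sequence (0-based: drop the first `n` entries). -/
def shiftTail (i : ℕ → Bool) (n : ℕ) : ℕ → Bool := fun k => i (n + k)

/-- `Omega a b` : sequences none of whose tails lies in the open lexicographic interval `]a,b[`. -/
def Omega (a b : ℕ → Bool) : Set (ℕ → Bool) :=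
  {i | ∀ n : ℕ, ¬ (lexLt a (shiftTail i n) ∧ lexLt (shiftTail i n) b)}

/-- `(a,b) ∈ W` : `a` starts with digit 0, `b` starts with digit 1, and `a, b ∈ Ω_{a,b}`. -/
def memW (a b : ℕ → Bool) : Prop :=
  a 0 = false ∧ b 0 = true ∧ a ∈ Omega a b ∧ b ∈ Omega a b

/-- The set `L_{a,b,n}` of length-`n` prefixes of elements of `Ω_{a,b}`, as a finset. -/
noncomputable def Lwords (a b : ℕ → Bool) (n : ℕ) : Finset (Fin n → Bool) :=
  Set.Finite.toFinset
    (Set.toFinite {w : Fin n → Bool | ∃ i ∈ Omega a b, ∀ k : Fin n, i k.1 = w k})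

/-- Topological entropy `h(Ω_{a,b}) = lim_{n→∞} (1/n) log #L_{a,b,n}`; the limit exists by
subadditivity, hence it coincides with the `limsup` used here. -/
noncomputable def entropy (a b : ℕ → Bool) : ℝ :=
  Filter.limsup (fun n : ℕ => Real.log ((Lwords a b n).card) / n) Filter.atTop

/-- The univoque set `𝒰_{q₀,q₁}` of reals with exactly one `(q₀,q₁)`-expansion. -/
def univoque (q0 q1 : ℝ) : Set ℝ := {x | ∃! i : ℕ → Bool, piE q0 q1 i = x}

/-- The generalized Komornik–Loreti constant
`𝒦(q₀) = inf {q₁ > 1 : 𝒰_{q₀,q₁} is uncountable}`. -/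
noncomputable def Kconst (q0 : ℝ) : ℝ := sInf {q1 : ℝ | 1 < q1 ∧ ¬ (univoque q0 q1).Countable}


/-! ### Part 1: basic facts on `piE` -/

namespace DB

theorem qb_false (q0 q1 : ℝ) : qb q0 q1 false = q0 := by simp [qb]
theorem qb_true (q0 q1 : ℝ) : qb q0 q1 true = q1 := by simp [qb]

theorem qb_ge {q0 q1 κ : ℝ} (h0 : κ ≤ q0) (h1 : κ ≤ q1) (d : Bool) : κ ≤ qb q0 q1 d := by
  cases d <;> simp [qb, h0, h1]

theorem qb_gt {q0 q1 κ : ℝ} (h0 : κ < q0) (h1 : κ < q1) (d : Bool) : κ < qb q0 q1 d := by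
  cases d <;> simp [qb, h0, h1]

theorem qb_prod_ge {q0 q1 κ : ℝ} (hκ : 1 < κ) (h0 : κ ≤ q0) (h1 : κ ≤ q1) (i : ℕ → Bool) (n : ℕ) :
    κ ^ n ≤ ∏ j ∈ Finset.range n, qb q0 q1 (i j) := by
  induction n with
  | zero => simp
  | succ n ih =>
    rw [pow_succ, Finset.prod_range_succ]
    have := qb_ge h0 h1 (i n)
    have h' : 0 ≤ κ ^ n := by positivity
    exact mul_le_mul ih this (by linarith) (h'.trans ih)

theorem qb_prod_pos {q0 q1 : ℝ} (h0 : 1 < q0) (h1 : 1 < q1) (i : ℕ → Bool) (n : ℕ) :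
    0 < ∏ j ∈ Finset.range n, qb q0 q1 (i j) :=
  Finset.prod_pos fun j _ => lt_trans one_pos (qb_gt h0 h1 (i j))

theorem term_bound {q0 q1 κ : ℝ} (hκ : 1 < κ) (h0 : κ ≤ q0) (h1 : κ ≤ q1) (i : ℕ → Bool) (k : ℕ) :
    ‖(if i k then (1 : ℝ) else 0) / ∏ j ∈ Finset.range (k + 1), qb q0 q1 (i j)‖ ≤ (κ⁻¹) ^ (k + 1) := by
  have h := qb_prod_ge hκ h0 h1 i (k + 1)
  have hp : 0 < κ ^ (k + 1) := by positivity
  have hpos := lt_of_lt_of_le hp h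
  rw [norm_div, Real.norm_of_nonneg hpos.le, inv_pow]
  rw [div_le_iff₀ hpos]
  have : (1 : ℝ) ≤ (κ ^ (k + 1))⁻¹ * ∏ j ∈ Finset.range (k + 1), qb q0 q1 (i j) := by
    rw [inv_mul_eq_div, le_div_iff₀ hp]; linarith
  refine le_trans ?_ this
  split_ifs <;> simp

theorem geo_summable {κ : ℝ} (hκ : 1 < κ) : Summable fun k : ℕ => (κ⁻¹) ^ (k + 1) := by
  have : Summable fun k : ℕ => (κ⁻¹) ^ k :=
    summable_geometric_of_lt_one (by positivity) (inv_lt_one_of_one_lt₀ hκ)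
  exact (summable_nat_add_iff 1).2 this

theorem term_summable {q0 q1 : ℝ} (h0 : 1 < q0) (h1 : 1 < q1) (i : ℕ → Bool) :
    Summable fun k : ℕ => (if i k then (1 : ℝ) else 0) / ∏ j ∈ Finset.range (k + 1), qb q0 q1 (i j) := by
  have hκ : 1 < min q0 q1 := lt_min h0 h1
  exact Summable.of_norm_bounded (geo_summable hκ)
    (term_bound hκ (min_le_left _ _) (min_le_right _ _) i)

theorem piE_rec {q0 q1 : ℝ} (h0 : 1 < q0) (h1 : 1 < q1) (i : ℕ → Bool) :
    piE q0 q1 i = ((if i 0 then (1 : ℝ) else 0) + piE q0 q1 (shiftTail i 1)) / qb q0 q1 (i 0) := by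
  unfold piE
  rw [(term_summable h0 h1 i).tsum_eq_zero_add, add_div]
  congr 1
  · simp
  · rw [← tsum_div_const]
    refine tsum_congr fun k => ?_
    rw [Finset.prod_range_succ' _ (k + 1)]
    simp only [shiftTail, add_comm 1]
    rw [div_div]

theorem piE_rec0 {q0 q1 : ℝ} (h0 : 1 < q0) (h1 : 1 < q1) {i : ℕ → Bool} (hi : i 0 = false) :
    piE q0 q1 i = piE q0 q1 (shiftTail i 1) / q0 := by
  rw [piE_rec h0 h1]; simp [hi, qb]

theorem piE_rec1 {q0 q1 : ℝ} (h0 : 1 < q0) (h1 : 1 < q1) {i : ℕ → Bool} (hi : i 0 = true) :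
    piE q0 q1 i = (1 + piE q0 q1 (shiftTail i 1)) / q1 := by
  rw [piE_rec h0 h1]; simp [hi, qb]

theorem shift_shift (i : ℕ → Bool) (n m : ℕ) : shiftTail (shiftTail i n) m = shiftTail i (n + m) := by
  funext k; simp [shiftTail, add_assoc]

theorem shift_zero (i : ℕ → Bool) : shiftTail i 0 = i := by
  funext k; simp [shiftTail]

theorem shift_at (i : ℕ → Bool) (n : ℕ) : shiftTail i n 0 = i n := by simp [shiftTail]

theorem piE_nonneg {q0 q1 : ℝ} (h0 : 1 < q0) (h1 : 1 < q1) (i : ℕ → Bool) : 0 ≤ piE q0 q1 i := by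
  refine tsum_nonneg fun k => div_nonneg ?_ (qb_prod_pos h0 h1 i _).le
  split_ifs <;> simp

/-- contraction principle -/
theorem le_zero_of_contr {e C κ : ℝ} (hκ0 : 0 ≤ κ) (hκ : κ < 1) (h : ∀ K : ℕ, e ≤ C * κ ^ K) : e ≤ 0 := by
  have ht : Tendsto (fun K : ℕ => C * κ ^ K) atTop (𝓝 (C * 0)) :=
    (tendsto_pow_atTop_nhds_zero_of_lt_one hκ0 hκ).const_mul C
  rw [mul_zero] at ht
  exact ge_of_tendsto' ht h

theorem piE_bdd {q0 q1 : ℝ} (h0 : 1 < q0) (h1 : 1 < q1) : ∃ C, 0 ≤ C ∧ ∀ i, piE q0 q1 i ≤ C := by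
  have hκ : 1 < min q0 q1 := lt_min h0 h1
  refine ⟨∑' k : ℕ, ((min q0 q1)⁻¹) ^ (k + 1), tsum_nonneg fun k => by positivity, fun i => ?_⟩
  refine (term_summable h0 h1 i).tsum_le_tsum (fun k => ?_) (geo_summable hκ)
  exact (le_abs_self _).trans (term_bound hκ (min_le_left _ _) (min_le_right _ _) i k)

theorem piE_le {q0 q1 : ℝ} (h0 : 1 < q0) (h1 : 1 < q1) (i : ℕ → Bool) : piE q0 q1 i ≤ 1 / (q1 - 1) := by
  obtain ⟨C, hC, hb⟩ := piE_bdd h0 h1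
  have hκ : 1 < min q0 q1 := lt_min h0 h1
  set κ := (min q0 q1)⁻¹ with hκd
  have hk1 : κ < 1 := inv_lt_one_of_one_lt₀ hκ
  have hk0 : 0 < κ := by positivity
  have hq0 : 1 / q0 ≤ κ := by
    rw [one_div]; exact inv_anti₀ (by positivity) (min_le_left _ _)
  have hq1 : 1 / q1 ≤ κ := by
    rw [one_div]; exact inv_anti₀ (by positivity) (min_le_right _ _)
  have hm : 0 < 1 / (q1 - 1) := by
    have : 0 < q1 - 1 := by linarith
    positivity
  have key : ∀ K : ℕ, ∀ i, piE q0 q1 i - 1 / (q1 - 1) ≤ C * κ ^ K := by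
    intro K
    induction K with
    | zero => intro i; have := hb i; rw [pow_zero, mul_one]; linarith
    | succ K ih =>
      intro i
      have h := ih (shiftTail i 1)
      have hCK : 0 ≤ C * κ ^ K := by positivity
      rw [pow_succ, ← mul_assoc]
      cases hi : i 0
      · rw [piE_rec0 h0 h1 hi]
        have e1 : piE q0 q1 (shiftTail i 1) / q0 ≤ (1 / (q1 - 1) + C * κ ^ K) * (1 / q0) := by
          rw [div_eq_mul_one_div]
          have : 0 < 1 / q0 := by positivity
          gcongr; linarith
        have e2 : 1 / (q1 - 1) * (1 / q0) ≤ 1 / (q1 - 1) * 1 := by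
          have : 1 / q0 ≤ 1 := by linarith
          gcongr
        have e3 : C * κ ^ K * (1 / q0) ≤ C * κ ^ K * κ := by gcongr
        nlinarith
      · rw [piE_rec1 h0 h1 hi]
        have e1 : (1 + piE q0 q1 (shiftTail i 1)) / q1 ≤ (1 + 1 / (q1 - 1) + C * κ ^ K) * (1 / q1) := by
          rw [div_eq_mul_one_div]
          have : 0 < 1 / q1 := by positivity
          refine mul_le_mul_of_nonneg_right ?_ this.le
          linarith
        have e2 : (1 + 1 / (q1 - 1)) * (1 / q1) = 1 / (q1 - 1) := by
          have : q1 - 1 ≠ 0 := by linarith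
          have : q1 ≠ 0 := by linarith
          field_simp; ring
        have e3 : C * κ ^ K * (1 / q1) ≤ C * κ ^ K * κ := by gcongr
        nlinarith
  have := le_zero_of_contr hk0.le hk1 (fun K => key K i)
  linarith

theorem piE_le0 {q0 q1 : ℝ} (h0 : 1 < q0) (h1 : 1 < q1) {i : ℕ → Bool} (hi : i 0 = false) :
    piE q0 q1 i ≤ 1 / (q0 * (q1 - 1)) := by
  rw [piE_rec0 h0 h1 hi, mul_comm, ← div_div]
  have := piE_le h0 h1 (shiftTail i 1)
  gcongr

theorem piE_ge1 {q0 q1 : ℝ} (h0 : 1 < q0) (h1 : 1 < q1) {i : ℕ → Bool} (hi : i 0 = true) :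
    1 / q1 ≤ piE q0 q1 i := by
  rw [piE_rec1 h0 h1 hi]
  have := piE_nonneg h0 h1 (shiftTail i 1)
  gcongr; linarith

theorem mpos {q1 : ℝ} (h1 : 1 < q1) : 0 < 1 / (q1 - 1) := by
  have : 0 < q1 - 1 := by linarith
  positivity

theorem piE_zeros (q0 q1 : ℝ) : piE q0 q1 (fun _ => false) = 0 := by simp [piE]

theorem piE_ones {q0 q1 : ℝ} (h0 : 1 < q0) (h1 : 1 < q1) :
    piE q0 q1 (fun _ => true) = 1 / (q1 - 1) := by
  have := piE_rec1 h0 h1 (i := fun _ => true) rfl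
  have e : shiftTail (fun _ => true) 1 = fun _ => true := rfl
  rw [e] at this
  have h1' : q1 - 1 ≠ 0 := by linarith
  have h1'' : q1 ≠ 0 := by linarith
  rw [eq_div_iff h1'] 
  rw [eq_div_iff h1''] at this
  linarith

theorem eq_zeros {q0 q1 : ℝ} (h0 : 1 < q0) (h1 : 1 < q1) (i : ℕ → Bool) (h : piE q0 q1 i = 0) :
    i = fun _ => false := by
  have : ∀ n, piE q0 q1 (shiftTail i n) = 0 ∧ (∀ k < n, i k = false) := by
    intro n
    induction n with
    | zero => simp [shift_zero, h]
    | succ n ih =>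
      cases hn : i n
      · refine ⟨?_, fun k hk => ?_⟩
        · have := piE_rec0 h0 h1 (i := shiftTail i n) (by rw [shift_at, hn])
          rw [ih.1, shift_shift] at this
          have h' : q0 ≠ 0 := by linarith
          rw [eq_div_iff h'] at this; linarith
        · rcases Nat.lt_succ_iff_lt_or_eq.1 hk with h | rfl
          · exact ih.2 k h
          · exact hn
      · exfalso
        have := piE_ge1 h0 h1 (i := shiftTail i n) (by rw [shift_at, hn])
        rw [ih.1] at this
        have : 0 < 1 / q1 := by positivity
        linarith
  funext k
  exact (this (k + 1)).2 k (Nat.lt_succ_self k)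

theorem eq_ones {q0 q1 : ℝ} (h0 : 1 < q0) (h1 : 1 < q1) (i : ℕ → Bool)
    (h : piE q0 q1 i = 1 / (q1 - 1)) : i = fun _ => true := by
  have hm := mpos h1
  have : ∀ n, piE q0 q1 (shiftTail i n) = 1 / (q1 - 1) ∧ (∀ k < n, i k = true) := by
    intro n
    induction n with
    | zero => simp [shift_zero, h]
    | succ n ih =>
      cases hn : i n
      · exfalso
        have := piE_le0 h0 h1 (i := shiftTail i n) (by rw [shift_at, hn])
        rw [ih.1, mul_comm, ← div_div] at this
        have := div_lt_self hm h0
        linarith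
      · refine ⟨?_, fun k hk => ?_⟩
        · have := piE_rec1 h0 h1 (i := shiftTail i n) (by rw [shift_at, hn])
          rw [ih.1, shift_shift] at this
          have h' : q1 ≠ 0 := by linarith
          have h'' : q1 - 1 ≠ 0 := by linarith
          rw [eq_div_iff h', ] at this
          field_simp at this ⊢
          linarith
        · rcases Nat.lt_succ_iff_lt_or_eq.1 hk with h | rfl
          · exact ih.2 k h
          · exact hn
  funext k
  exact (this (k + 1)).2 k (Nat.lt_succ_self k)

/-- difference formula -/
theorem piE_diff {q0 q1 : ℝ} (h0 : 1 < q0) (h1 : 1 < q1) (n : ℕ) (i j : ℕ → Bool)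
    (h : ∀ k < n, i k = j k) :
    piE q0 q1 i - piE q0 q1 j =
      (∏ k ∈ Finset.range n, qb q0 q1 (i k))⁻¹ *
        (piE q0 q1 (shiftTail i n) - piE q0 q1 (shiftTail j n)) := by
  induction n with
  | zero => simp [shift_zero]
  | succ n ih =>
    rw [ih fun k hk => h k (by omega), Finset.prod_range_succ, mul_inv, mul_assoc]
    congr 1
    have hn := h n (Nat.lt_succ_self n)
    rw [piE_rec h0 h1 (shiftTail i n), piE_rec h0 h1 (shiftTail j n), shift_at, shift_at, ← hn,
      shift_shift, shift_shift, ← sub_div]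
    rw [div_eq_inv_mul]; ring

/-- first difference -/
theorem first_diff {i j : ℕ → Bool} (h : i ≠ j) : ∃ n, (∀ k < n, i k = j k) ∧ i n ≠ j n := by
  classical
  have : ∃ n, i n ≠ j n := by
    by_contra hh; push Not at hh; exact h (funext hh)
  refine ⟨Nat.find this, fun k hk => ?_, Nat.find_spec this⟩
  have := Nat.find_min this hk
  simpa using this

/-- itineraries -/
theorem itin {p0 p1 c x : ℝ} (h0 : 1 < p0) (h1 : 1 < p1) (hc1 : 1 / p1 ≤ c)
    (hc0 : c ≤ 1 / (p0 * (p1 - 1))) (hx0 : 0 ≤ x) (hx1 : x ≤ 1 / (p1 - 1)) :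
    ∃ i : ℕ → Bool, piE p0 p1 i = x ∧ ∀ n,
      (i n = false → piE p0 p1 (shiftTail i n) < c) ∧
      (i n = true → c ≤ piE p0 p1 (shiftTail i n)) := by
  classical
  let G : ℝ → ℝ := fun y => if c ≤ y then p1 * y - 1 else p0 * y
  let y : ℕ → ℝ := fun n => G^[n] x
  have hy1 : ∀ n, y (n + 1) = G (y n) := fun n => Function.iterate_succ_apply' G n x
  let i : ℕ → Bool := fun n => decide (c ≤ y n)
  have hm := mpos h1
  have hp1 : p1 - 1 ≠ 0 := by linarith
  have hyb : ∀ n, 0 ≤ y n ∧ y n ≤ 1 / (p1 - 1) := by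
    intro n
    induction n with
    | zero => exact ⟨hx0, hx1⟩
    | succ n ih =>
      rw [hy1]
      simp only [G]
      split_ifs with hh
      · have e : p1 * (1 / (p1 - 1)) - 1 = 1 / (p1 - 1) := by field_simp; ring
        constructor
        · have : 1 / p1 ≤ y n := hc1.trans hh
          rw [div_le_iff₀ (by linarith)] at this
          linarith
        · rw [← e]; have := ih.2; gcongr
      · push Not at hh
        constructor
        · have := ih.1; positivity
        · have : y n ≤ 1 / (p0 * (p1 - 1)) := hh.le.trans hc0
          rw [mul_comm p0, ← div_div, le_div_iff₀ (by linarith)] at this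
          linarith
  have hκ : 1 < min p0 p1 := lt_min h0 h1
  set κ := (min p0 p1)⁻¹ with hκd
  have hk1 : κ < 1 := inv_lt_one_of_one_lt₀ hκ
  have hk0 : 0 < κ := by positivity
  have key : ∀ K : ℕ, ∀ n, |piE p0 p1 (shiftTail i n) - y n| ≤ 1 / (p1 - 1) * κ ^ K := by
    intro K
    induction K with
    | zero =>
      intro n
      have a1 := piE_nonneg h0 h1 (shiftTail i n)
      have a2 := piE_le h0 h1 (shiftTail i n)
      have a3 := hyb n
      rw [pow_zero, mul_one, abs_le]
      constructor <;> linarith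
    | succ K ih =>
      intro n
      have hK := ih (n + 1)
      have e : piE p0 p1 (shiftTail i n) - y n =
          (qb p0 p1 (i n))⁻¹ * (piE p0 p1 (shiftTail i (n + 1)) - y (n + 1)) := by
        rw [hy1]
        by_cases hh : c ≤ y n
        · have hi : i n = true := by simp [i, hh]
          rw [piE_rec1 h0 h1 (i := shiftTail i n) (by rw [shift_at, hi]), shift_shift, hi, qb_true]
          simp only [G, if_pos hh]
          field_simp; ring
        · have hi : i n = false := by simp only [i]; exact decide_eq_false hh
          rw [piE_rec0 h0 h1 (i := shiftTail i n) (by rw [shift_at, hi]), shift_shift, hi, qb_false]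
          simp only [G, if_neg hh]
          field_simp
      rw [e, abs_mul]
      have : |(qb p0 p1 (i n))⁻¹| ≤ κ := by
        have h := qb_ge (min_le_left p0 p1) (min_le_right p0 p1) (i n)
        rw [abs_of_pos (inv_pos.2 (by linarith))]
        exact inv_anti₀ (by linarith) h
      calc _ ≤ κ * (1 / (p1 - 1) * κ ^ K) := by gcongr
        _ = _ := by ring
  have heq : ∀ n, piE p0 p1 (shiftTail i n) = y n := by
    intro n
    have := le_zero_of_contr hk0.le hk1 (fun K => key K n)
    have := abs_nonpos_iff.1 this
    linarith
  refine ⟨i, ?_, fun n => ?_⟩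
  · have := heq 0; rw [shift_zero] at this; exact this
  · rw [heq]
    simp only [i]
    constructor
    · intro h; simpa using h
    · intro h; simpa using h

/-- joint continuity -/
theorem piE_cont {κ : ℝ} (hκ : 1 < κ) {T : Type*} [TopologicalSpace T] {f0 f1 : T → ℝ}
    {fi : T → ℕ → Bool} (c0 : Continuous f0) (c1 : Continuous f1) (ci : Continuous fi)
    (h0 : ∀ t, κ ≤ f0 t) (h1 : ∀ t, κ ≤ f1 t) :
    Continuous fun t => piE (f0 t) (f1 t) (fi t) := by
  have hb : ∀ k, Continuous fun t => fi t k := fun k => (continuous_apply k).comp ci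
  have hq : ∀ k, Continuous fun t => qb (f0 t) (f1 t) (fi t k) := by
    intro k
    unfold qb
    refine Continuous.if ?_ c1 c0
    intro a ha
    have : IsClopen {a | fi a k = true} := (isClopen_discrete {true}).preimage (hb k)
    rw [this.frontier_eq] at ha
    exact absurd ha (Set.notMem_empty _)
  unfold piE
  refine continuous_tsum (u := fun k : ℕ => (κ⁻¹) ^ (k + 1)) (fun k => ?_) (geo_summable hκ) ?_
  · refine Continuous.div ?_ (continuous_finsetProd _ fun j _ => hq j) fun t => ?_
    · refine Continuous.if ?_ continuous_const continuous_const
      intro a ha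
      have : IsClopen {a | fi a k = true} := (isClopen_discrete {true}).preimage (hb k)
      rw [this.frontier_eq] at ha
      exact absurd ha (Set.notMem_empty _)
    · exact (qb_prod_pos (hκ.trans_le (h0 t)) (hκ.trans_le (h1 t)) _ _).ne'
  · intro k t
    exact term_bound hκ (h0 t) (h1 t) (fi t) k


/-! ### Part 2: the restricted shift, Hölder comparison -/

def XS (r0 r1 α β : ℝ) : Set (ℕ → Bool) :=
  {i | ∀ n, (i n = false → piE r0 r1 (shiftTail i n) ≤ α) ∧
    (i n = true → β ≤ piE r0 r1 (shiftTail i n))}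

def V (q0 q1 : ℝ) : Set (ℕ → Bool) := XS q0 q1 (1 / q1) (1 / (q0 * (q1 - 1)))

theorem XS_shift {r0 r1 α β : ℝ} {i : ℕ → Bool} (h : i ∈ XS r0 r1 α β) (n : ℕ) :
    shiftTail i n ∈ XS r0 r1 α β := by
  intro m
  rw [shift_shift]
  exact h (n + m)

theorem XS_0 {r0 r1 α β : ℝ} {i : ℕ → Bool} (h : i ∈ XS r0 r1 α β) (h0 : i 0 = false) :
    piE r0 r1 i ≤ α := by
  have := (h 0).1 h0
  rwa [shift_zero] at this

theorem XS_1 {r0 r1 α β : ℝ} {i : ℕ → Bool} (h : i ∈ XS r0 r1 α β) (h0 : i 0 = true) :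
    β ≤ piE r0 r1 i := by
  have := (h 0).2 h0
  rwa [shift_zero] at this

/-- if there is no overlap then `V` is everything -/
theorem V_univ {q0 q1 : ℝ} (h0 : 1 < q0) (h1 : 1 < q1) (h : 1 / (q0 * (q1 - 1)) ≤ 1 / q1)
    (i : ℕ → Bool) : i ∈ V q0 q1 := by
  intro n
  constructor
  · intro hn
    exact (piE_le0 h0 h1 (by rw [shift_at, hn])).trans h
  · intro hn
    exact h.trans (piE_ge1 h0 h1 (by rw [shift_at, hn]))

noncomputable def wf (q0 q1 : ℝ) : List Bool → ℝ → ℝ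
  | [], x => x
  | d :: l, x => ((if d then (1 : ℝ) else 0) + wf q0 q1 l x) / qb q0 q1 d

theorem piE_wf {q0 q1 : ℝ} (h0 : 1 < q0) (h1 : 1 < q1) (n : ℕ) : ∀ i : ℕ → Bool,
    ∃ l : List Bool, piE q0 q1 i = wf q0 q1 l (piE q0 q1 (shiftTail i n)) := by
  induction n with
  | zero => intro i; exact ⟨[], by simp [wf, shift_zero]⟩
  | succ n ih =>
    intro i
    obtain ⟨l, hl⟩ := ih (shiftTail i 1)
    refine ⟨i 0 :: l, ?_⟩
    rw [piE_rec h0 h1, hl, shift_shift, add_comm 1 n]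
    rfl

theorem univoque_sub {q0 q1 : ℝ} (h0 : 1 < q0) (h1 : 1 < q1) :
    univoque q0 q1 ⊆ piE q0 q1 '' V q0 q1 := by
  classical
  rintro x ⟨i, hi, hu⟩
  refine ⟨i, ?_, hi⟩
  by_cases hAB : 1 / (q0 * (q1 - 1)) ≤ 1 / q1
  · exact V_univ h0 h1 hAB i
  push Not at hAB
  have hq1 : q1 - 1 ≠ 0 := by linarith
  have hq1' : q1 ≠ 0 := by linarith
  have hq0' : q0 ≠ 0 := by linarith
  -- replacing a tail
  have repl : ∀ n : ℕ, ∀ j : ℕ → Bool, piE q0 q1 j = piE q0 q1 (shiftTail i n) → j 0 = i n := by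
    intro n j hj
    let j' : ℕ → Bool := fun k => if k < n then i k else j (k - n)
    have hs : shiftTail j' n = j := by
      funext k; simp [shiftTail, j']
    have hd := piE_diff h0 h1 n i j' (fun k hk => by simp [j', hk])
    rw [hs, hj, sub_self, mul_zero] at hd
    have : j' = i := hu j' (by simp only; linarith)
    have := congrFun this n
    simpa [j'] using this
  intro n
  constructor
  · intro hn
    by_contra hlt
    push Not at hlt
    have hle := piE_le0 h0 h1 (i := shiftTail i n) (by rw [shift_at, hn])
    obtain ⟨j, hj, hj2⟩ := itin h0 h1 (c := 1 / q1) le_rfl hAB.le (piE_nonneg h0 h1 (shiftTail i n))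
      (piE_le h0 h1 _)
    have := repl n j hj
    rw [hn] at this
    have := (hj2 0).1 this
    rw [shift_zero, hj] at this
    linarith
  · intro hn
    by_contra hlt
    push Not at hlt
    obtain ⟨j, hj, hj2⟩ := itin h0 h1 (c := 1 / (q0 * (q1 - 1))) hAB.le le_rfl
      (piE_nonneg h0 h1 (shiftTail i n)) (piE_le h0 h1 _)
    have := repl n j hj
    rw [hn] at this
    have := (hj2 0).2 this
    rw [shift_zero, hj] at this
    linarith

theorem V_sub {q0 q1 : ℝ} (h0 : 1 < q0) (h1 : 1 < q1) :
    piE q0 q1 '' V q0 q1 ⊆ univoque q0 q1 ∪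
      Set.range (fun z : List Bool × Bool =>
        wf q0 q1 z.1 (if z.2 then 1 / q1 else 1 / (q0 * (q1 - 1)))) := by
  rintro x ⟨i, hi, hix⟩
  by_cases hx : ∃ j, j ≠ i ∧ piE q0 q1 j = x
  · right
    obtain ⟨j, hji, hj⟩ := hx
    obtain ⟨n, hn, hne⟩ := first_diff (Ne.symm hji)
    have hd := piE_diff h0 h1 n i j hn
    rw [hix, hj, sub_self, eq_comm, mul_eq_zero] at hd
    have hd := hd.resolve_left (inv_ne_zero (qb_prod_pos h0 h1 i n).ne')
    obtain ⟨l, hl⟩ := piE_wf h0 h1 n i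
    cases hin : i n
    · have hjn : j n = true := by
        rw [hin] at hne; revert hne; cases j n <;> simp
      have a1 := (hi n).1 hin
      have a2 := piE_ge1 h0 h1 (i := shiftTail j n) (by rw [shift_at, hjn])
      refine ⟨(l, true), ?_⟩
      have : piE q0 q1 (shiftTail i n) = 1 / q1 := by linarith
      simp only [if_true]
      rw [← this, ← hl, hix]
    · have hjn : j n = false := by
        rw [hin] at hne; revert hne; cases j n <;> simp
      have a1 := (hi n).2 hin
      have a2 := piE_le0 h0 h1 (i := shiftTail j n) (by rw [shift_at, hjn])
      refine ⟨(l, false), ?_⟩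
      have : piE q0 q1 (shiftTail i n) = 1 / (q0 * (q1 - 1)) := by linarith
      simp only [Bool.false_eq_true, if_false]
      rw [← this, ← hl, hix]
  · left
    push Not at hx
    refine ⟨i, hix, fun j hj => ?_⟩
    by_contra hne
    exact hx j hne hj

theorem dimH_univoque {q0 q1 : ℝ} (h0 : 1 < q0) (h1 : 1 < q1) :
    dimH (univoque q0 q1) = dimH (piE q0 q1 '' V q0 q1) := by
  apply le_antisymm (dimH_mono (univoque_sub h0 h1))
  refine (dimH_mono (V_sub h0 h1)).trans ?_
  rw [dimH_union, (Set.countable_range _).dimH_zero]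
  simp

/-- Hölder comparison of two projections of the same code set. -/
theorem holder_cmp {r0 r1 u0 u1 θ g : ℝ} (hr0 : 1 < r0) (hr1 : 1 < r1) (hu0 : 1 < u0) (hu1 : 1 < u1)
    (hθ : 0 < θ) (hg : 0 < g) (h0 : r0 ^ θ ≤ u0) (h1 : r1 ^ θ ≤ u1) (X : Set (ℕ → Bool))
    (hX : ∀ i ∈ X, ∀ n, shiftTail i n ∈ X)
    (hgap : ∀ i ∈ X, ∀ j ∈ X, i 0 = false → j 0 = true → piE r0 r1 i + g ≤ piE r0 r1 j) :
    dimH (piE u0 u1 '' X) ≤ dimH (piE r0 r1 '' X) / ENNReal.ofReal θ := by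
  classical
  have hm := mpos hu1
  set m := 1 / (u1 - 1) with hmd
  -- basic inequality
  have key : ∀ i ∈ X, ∀ j ∈ X, |piE u0 u1 i - piE u0 u1 j| ≤
      m / g ^ θ * |piE r0 r1 i - piE r0 r1 j| ^ θ := by
    intro i hi j hj
    by_cases hij : i = j
    · subst hij
      simp [Real.zero_rpow hθ.ne']
    obtain ⟨n, hn, hne⟩ := first_diff hij
    rw [piE_diff hu0 hu1 n i j hn, piE_diff hr0 hr1 n i j hn, abs_mul, abs_mul]
    have pu := qb_prod_pos hu0 hu1 i n
    have pr := qb_prod_pos hr0 hr1 i n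
    have e1 : |piE u0 u1 (shiftTail i n) - piE u0 u1 (shiftTail j n)| ≤ m := by
      have a1 := piE_nonneg hu0 hu1 (shiftTail i n)
      have a2 := piE_le hu0 hu1 (shiftTail i n)
      have a3 := piE_nonneg hu0 hu1 (shiftTail j n)
      have a4 := piE_le hu0 hu1 (shiftTail j n)
      rw [abs_le]; constructor <;> linarith
    have e2 : g ≤ |piE r0 r1 (shiftTail i n) - piE r0 r1 (shiftTail j n)| := by
      cases hin : i n
      · have hjn : j n = true := by
          rw [hin] at hne; revert hne; cases j n <;> simp
        have := hgap _ (hX i hi n) _ (hX j hj n) (by rw [shift_at, hin]) (by rw [shift_at, hjn])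
        rw [abs_sub_comm]
        exact le_trans (by linarith) (le_abs_self _)
      · have hjn : j n = false := by
          rw [hin] at hne; revert hne; cases j n <;> simp
        have := hgap _ (hX j hj n) _ (hX i hi n) (by rw [shift_at, hjn]) (by rw [shift_at, hin])
        exact le_trans (by linarith) (le_abs_self _)
    have e3 : (∏ k ∈ Finset.range n, qb r0 r1 (i k)) ^ θ ≤ ∏ k ∈ Finset.range n, qb u0 u1 (i k) := by
      rw [← Real.finsetProd_rpow _ _ (fun k _ => (zero_lt_one.trans (qb_gt hr0 hr1 (i k))).le)]
      refine Finset.prod_le_prod (fun k _ => Real.rpow_nonneg (zero_lt_one.trans (qb_gt hr0 hr1 (i k))).le _) fun k _ => ?_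
      cases i k
      · simpa [qb] using h0
      · simpa [qb] using h1
    rw [abs_of_pos (inv_pos.2 pu), abs_of_pos (inv_pos.2 pr)]
    rw [Real.mul_rpow (inv_pos.2 pr).le (abs_nonneg _), Real.inv_rpow pr.le]
    have prθ := Real.rpow_pos_of_pos pr θ
    have gθ := Real.rpow_pos_of_pos hg θ
    have e4 : g ^ θ ≤ |piE r0 r1 (shiftTail i n) - piE r0 r1 (shiftTail j n)| ^ θ :=
      Real.rpow_le_rpow hg.le e2 hθ.le
    calc _ ≤ ((∏ k ∈ Finset.range n, qb r0 r1 (i k)) ^ θ)⁻¹ * m := by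
          refine mul_le_mul ?_ e1 (abs_nonneg _) (inv_pos.2 prθ).le
          exact inv_anti₀ prθ e3
      _ = m / g ^ θ * (((∏ k ∈ Finset.range n, qb r0 r1 (i k)) ^ θ)⁻¹ * g ^ θ) := by
          field_simp
      _ ≤ _ := by
          have := (inv_pos.2 prθ).le
          gcongr
  -- the map
  let code : ℝ → (ℕ → Bool) := fun x => if h : ∃ i ∈ X, piE r0 r1 i = x then h.choose else fun _ => false
  have hcode : ∀ x ∈ piE r0 r1 '' X, code x ∈ X ∧ piE r0 r1 (code x) = x := by
    rintro x ⟨i, hi, hx⟩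
    have h : ∃ i ∈ X, piE r0 r1 i = x := ⟨i, hi, hx⟩
    simp only [code, dif_pos h]
    exact h.choose_spec
  let f : ℝ → ℝ := fun x => piE u0 u1 (code x)
  have hf : ∀ i ∈ X, f (piE r0 r1 i) = piE u0 u1 i := by
    intro i hi
    obtain ⟨a, b⟩ := hcode _ ⟨i, hi, rfl⟩
    have := key _ a _ hi
    rw [b, sub_self, abs_zero, Real.zero_rpow hθ.ne', mul_zero] at this
    have := abs_nonpos_iff.1 this
    simp only [f]; linarith
  have himg : piE u0 u1 '' X = f '' (piE r0 r1 '' X) := by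
    rw [Set.image_image]
    exact Set.image_congr fun i hi => (hf i hi).symm
  have hC : 0 ≤ m / g ^ θ := div_nonneg hm.le (Real.rpow_nonneg hg.le _)
  have hold : HolderOnWith (m / g ^ θ).toNNReal θ.toNNReal f (piE r0 r1 '' X) := by
    rintro x hx y hy
    obtain ⟨a, b⟩ := hcode x hx
    obtain ⟨a', b'⟩ := hcode y hy
    have := key _ a _ a'
    rw [b, b'] at this
    rw [edist_dist, edist_dist, Real.dist_eq, Real.dist_eq]
    rw [Real.coe_toNNReal _ hθ.le, ENNReal.ofReal_rpow_of_nonneg (abs_nonneg _) hθ.le]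
    rw [← ENNReal.ofReal_coe_nnreal, Real.coe_toNNReal _ hC, ← ENNReal.ofReal_mul hC]
    exact ENNReal.ofReal_le_ofReal this
  rw [himg]
  exact hold.dimH_image_le (Real.toNNReal_pos.2 hθ)


/-! ### Part 3: compactness, gaps, critical exponents -/

theorem closed_digit {T : Type*} [TopologicalSpace T] {fi : T → ℕ → Bool} (ci : Continuous fi)
    (n : ℕ) (d : Bool) : IsClopen {t | fi t n = d} :=
  (isClopen_discrete {d}).preimage ((continuous_apply n).comp ci)

theorem shift_cont {T : Type*} [TopologicalSpace T] {fi : T → ℕ → Bool} (ci : Continuous fi) (n : ℕ) :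
    Continuous fun t => shiftTail (fi t) n := by
  refine continuous_pi fun k => ?_
  exact (continuous_apply (n + k)).comp ci

theorem closed_XS {κ : ℝ} (hκ : 1 < κ) {T : Type*} [TopologicalSpace T] {f0 f1 α β : T → ℝ}
    {fi : T → ℕ → Bool} (c0 : Continuous f0) (c1 : Continuous f1) (ci : Continuous fi)
    (cα : Continuous α) (cβ : Continuous β)
    (h0 : ∀ t, κ ≤ f0 t) (h1 : ∀ t, κ ≤ f1 t) :
    IsClosed {t | fi t ∈ XS (f0 t) (f1 t) (α t) (β t)} := by
  have e : {t | fi t ∈ XS (f0 t) (f1 t) (α t) (β t)} = ⋂ n : ℕ,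
      ({t | fi t n = false → piE (f0 t) (f1 t) (shiftTail (fi t) n) ≤ α t} ∩
        {t | fi t n = true → β t ≤ piE (f0 t) (f1 t) (shiftTail (fi t) n)}) := by
    ext t
    simp only [Set.mem_iInter]
    rfl
  rw [e]
  refine isClosed_iInter fun n => ?_
  have hp : Continuous fun t => piE (f0 t) (f1 t) (shiftTail (fi t) n) :=
    piE_cont hκ c0 c1 (shift_cont ci n) h0 h1
  refine IsClosed.inter ?_ ?_
  · exact isClosed_imp (closed_digit ci n false).isOpen (isClosed_le hp cα)
  · exact isClosed_imp (closed_digit ci n true).isOpen (isClosed_le cβ hp)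

/-- no gap in base `(r0,r1)` -/
def NG (q0 q1 r0 r1 : ℝ) : Prop :=
  ∃ i j : ℕ → Bool, i ∈ V q0 q1 ∧ j ∈ V q0 q1 ∧ i 0 = false ∧ j 0 = true ∧ piE r0 r1 j ≤ piE r0 r1 i

theorem closed_NG {κ : ℝ} (hκ : 1 < κ) {T : Type*} [TopologicalSpace T] {f0 f1 g0 g1 : T → ℝ}
    (c0 : Continuous f0) (c1 : Continuous f1) (d0 : Continuous g0) (d1 : Continuous g1)
    (h0 : ∀ t, κ ≤ f0 t) (h1 : ∀ t, κ ≤ f1 t) (k0 : ∀ t, κ ≤ g0 t) (k1 : ∀ t, κ ≤ g1 t) :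
    IsClosed {t | NG (f0 t) (f1 t) (g0 t) (g1 t)} := by
  let S : Set (T × ((ℕ → Bool) × (ℕ → Bool))) :=
    {z | z.2.1 ∈ V (f0 z.1) (f1 z.1)} ∩ ({z | z.2.2 ∈ V (f0 z.1) (f1 z.1)} ∩
      ({z | z.2.1 0 = false} ∩ ({z | z.2.2 0 = true} ∩
        {z | piE (g0 z.1) (g1 z.1) z.2.2 ≤ piE (g0 z.1) (g1 z.1) z.2.1})))
  have e : {t | NG (f0 t) (f1 t) (g0 t) (g1 t)} = Prod.fst '' S := by
    ext t
    constructor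
    · rintro ⟨i, j, h⟩
      exact ⟨(t, (i, j)), h, rfl⟩
    · rintro ⟨⟨t', i, j⟩, h, rfl⟩
      exact ⟨i, j, h⟩
  rw [e]
  apply isClosedMap_fst_of_compactSpace
  have hA : Continuous fun z : T × ((ℕ → Bool) × (ℕ → Bool)) => 1 / f1 z.1 :=
    continuous_const.div (c1.comp continuous_fst) fun z => by have := h1 z.1; linarith
  have hB : Continuous fun z : T × ((ℕ → Bool) × (ℕ → Bool)) => 1 / (f0 z.1 * (f1 z.1 - 1)) := by
    refine continuous_const.div ((c0.comp continuous_fst).mul ((c1.comp continuous_fst).sub continuous_const)) fun z => ?_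
    have a1 := h1 z.1
    have a0 := h0 z.1
    exact (mul_pos (by linarith) (by linarith)).ne'
  refine IsClosed.inter ?_ (IsClosed.inter ?_ (IsClosed.inter ?_ (IsClosed.inter ?_ ?_)))
  · exact closed_XS hκ (c0.comp continuous_fst) (c1.comp continuous_fst)
      (continuous_fst.comp continuous_snd) hA hB (fun z => h0 z.1) (fun z => h1 z.1)
  · exact closed_XS hκ (c0.comp continuous_fst) (c1.comp continuous_fst)
      (continuous_snd.comp continuous_snd) hA hB (fun z => h0 z.1) (fun z => h1 z.1)
  · exact (closed_digit (continuous_fst.comp continuous_snd) 0 false).isClosed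
  · exact (closed_digit (continuous_snd.comp continuous_snd) 0 true).isClosed
  · exact isClosed_le
      (piE_cont hκ (d0.comp continuous_fst) (d1.comp continuous_fst)
        (continuous_snd.comp continuous_snd) (fun z => k0 z.1) (fun z => k1 z.1))
      (piE_cont hκ (d0.comp continuous_fst) (d1.comp continuous_fst)
        (continuous_fst.comp continuous_snd) (fun z => k0 z.1) (fun z => k1 z.1))

theorem isCompact_V {q0 q1 : ℝ} (h0 : 1 < q0) (h1 : 1 < q1) : IsCompact (V q0 q1) := by
  have : IsClosed {i : ℕ → Bool | i ∈ XS q0 q1 (1 / q1) (1 / (q0 * (q1 - 1)))} :=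
    closed_XS (lt_min h0 h1) continuous_const continuous_const
      continuous_id continuous_const continuous_const (fun _ => min_le_left _ _) (fun _ => min_le_right _ _)
  exact IsClosed.isCompact this

theorem piE_cont1 {q0 q1 : ℝ} (h0 : 1 < q0) (h1 : 1 < q1) : Continuous fun i => piE q0 q1 i :=
  piE_cont (lt_min h0 h1) continuous_const continuous_const
      continuous_id (fun _ => min_le_left _ _) (fun _ => min_le_right _ _)

/-- failure of `NG` yields a uniform gap -/
theorem unif_gap {q0 q1 r0 r1 : ℝ} (h0 : 1 < q0) (h1 : 1 < q1) (k0 : 1 < r0) (k1 : 1 < r1)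
    (h : ¬ NG q0 q1 r0 r1) : ∃ g > 0, ∀ i ∈ V q0 q1, ∀ j ∈ V q0 q1, i 0 = false → j 0 = true →
      piE r0 r1 i + g ≤ piE r0 r1 j := by
  let S : Set ((ℕ → Bool) × (ℕ → Bool)) :=
    (V q0 q1 ∩ {i | i 0 = false}) ×ˢ (V q0 q1 ∩ {i | i 0 = true})
  have hS : IsCompact S :=
    ((isCompact_V h0 h1).inter_right (closed_digit continuous_id 0 false).isClosed).prod
      ((isCompact_V h0 h1).inter_right (closed_digit continuous_id 0 true).isClosed)
  have hf : Continuous fun z : (ℕ → Bool) × (ℕ → Bool) => piE r0 r1 z.2 - piE r0 r1 z.1 :=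
    ((piE_cont1 k0 k1).comp continuous_snd).sub ((piE_cont1 k0 k1).comp continuous_fst)
  rcases S.eq_empty_or_nonempty with he | hne
  · refine ⟨1, one_pos, fun i hi j hj hi0 hj0 => ?_⟩
    have : (i, j) ∈ S := ⟨⟨hi, hi0⟩, ⟨hj, hj0⟩⟩
    rw [he] at this; exact absurd this (Set.notMem_empty _)
  · obtain ⟨z, hz, hmin⟩ := hS.exists_isMinOn hne hf.continuousOn
    refine ⟨piE r0 r1 z.2 - piE r0 r1 z.1, ?_, fun i hi j hj hi0 hj0 => ?_⟩
    · by_contra hle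
      exact h ⟨z.1, z.2, hz.1.1, hz.2.1, hz.1.2, hz.2.2, by linarith⟩
    · have := isMinOn_iff.1 hmin (i, j) ⟨⟨hi, hi0⟩, ⟨hj, hj0⟩⟩
      simp only at this
      linarith

theorem gap_dim {q0 q1 s : ℝ} (h0 : 1 < q0) (h1 : 1 < q1) (hs : 0 < s)
    (h : ¬ NG q0 q1 (q0 ^ s) (q1 ^ s)) : dimH (univoque q0 q1) ≤ ENNReal.ofReal s := by
  have k0 := Real.one_lt_rpow h0 hs
  have k1 := Real.one_lt_rpow h1 hs
  obtain ⟨g, hg, hgap⟩ := unif_gap h0 h1 k0 k1 h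
  rw [dimH_univoque h0 h1]
  have := holder_cmp k0 k1 h0 h1 (inv_pos.2 hs) hg
    (by rw [← Real.rpow_mul (by linarith), mul_inv_cancel₀ hs.ne', Real.rpow_one])
    (by rw [← Real.rpow_mul (by linarith), mul_inv_cancel₀ hs.ne', Real.rpow_one])
    (V q0 q1) (fun i hi n => XS_shift hi n) hgap
  refine this.trans ?_
  have hd : dimH (piE (q0 ^ s) (q1 ^ s) '' V q0 q1) ≤ 1 := by
    refine (dimH_mono (Set.subset_univ _)).trans ?_
    rw [Real.dimH_univ]
  calc _ ≤ 1 / ENNReal.ofReal s⁻¹ := by gcongr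
    _ = _ := by rw [ENNReal.ofReal_inv_of_pos hs, one_div, inv_inv]

/-- critical exponent -/
theorem crit {q0 q1 s : ℝ} (h0 : 1 < q0) (h1 : 1 < q1) (hs : 0 < s)
    (h : NG q0 q1 (q0 ^ s) (q1 ^ s)) : ∃ u ≥ s, ∃ a ∈ V q0 q1, ∃ b ∈ V q0 q1, ∃ c,
      a 0 = false ∧ b 0 = true ∧ piE (q0 ^ u) (q1 ^ u) a = c ∧ piE (q0 ^ u) (q1 ^ u) b = c ∧
      (∀ i ∈ V q0 q1, i 0 = false → piE (q0 ^ u) (q1 ^ u) i ≤ c) ∧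
      (∀ i ∈ V q0 q1, i 0 = true → c ≤ piE (q0 ^ u) (q1 ^ u) i) := by
  have hκ : 1 < min (min q0 q1) (min (q0 ^ s) (q1 ^ s)) :=
    lt_min (lt_min h0 h1) (lt_min (Real.one_lt_rpow h0 hs) (Real.one_lt_rpow h1 hs))
  set κ := min (min q0 q1) (min (q0 ^ s) (q1 ^ s)) with hκd
  have kq0 : κ ≤ q0 := (min_le_left _ _).trans (min_le_left _ _)
  have kq1 : κ ≤ q1 := (min_le_left _ _).trans (min_le_right _ _)
  have kr0 : κ ≤ q0 ^ s := (min_le_right _ _).trans (min_le_left _ _)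
  have kr1 : κ ≤ q1 ^ s := (min_le_right _ _).trans (min_le_right _ _)
  have cq0 : Continuous fun t : ℝ => q0 ^ (max t s) :=
    continuous_const.rpow (continuous_id.max continuous_const) fun t => Or.inl (by linarith)
  have cq1 : Continuous fun t : ℝ => q1 ^ (max t s) :=
    continuous_const.rpow (continuous_id.max continuous_const) fun t => Or.inl (by linarith)
  have mq0 : ∀ t : ℝ, κ ≤ q0 ^ (max t s) := fun t =>
    kr0.trans (Real.rpow_le_rpow_of_exponent_le h0.le (le_max_right _ _))
  have mq1 : ∀ t : ℝ, κ ≤ q1 ^ (max t s) := fun t =>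
    kr1.trans (Real.rpow_le_rpow_of_exponent_le h1.le (le_max_right _ _))
  have hcl : IsClosed {t : ℝ | NG q0 q1 (q0 ^ (max t s)) (q1 ^ (max t s))} :=
    closed_NG hκ continuous_const continuous_const cq0 cq1 (fun _ => kq0) (fun _ => kq1) mq0 mq1
  -- bounded
  have ht0 : ∀ᶠ t : ℝ in atTop, 2 < q0 ^ t := (tendsto_rpow_atTop_of_base_gt_one q0 h0).eventually_gt_atTop 2
  have ht1 : ∀ᶠ t : ℝ in atTop, 2 < q1 ^ t := (tendsto_rpow_atTop_of_base_gt_one q1 h1).eventually_gt_atTop 2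
  obtain ⟨T, hT⟩ := eventually_atTop.1 (ht0.and ht1)
  have hbd : ∀ t, NG q0 q1 (q0 ^ (max t s)) (q1 ^ (max t s)) → t ≤ T := by
    rintro t ⟨i, j, hi, hj, hi0, hj0, hle⟩
    by_contra hlt
    push Not at hlt
    obtain ⟨a0, a1⟩ := hT (max t s) (hlt.le.trans (le_max_left _ _))
    set r0 := q0 ^ (max t s)
    set r1 := q1 ^ (max t s)
    have b1 := piE_le0 (q0 := r0) (q1 := r1) (by linarith) (by linarith) hi0
    have b2 := piE_ge1 (q0 := r0) (q1 := r1) (by linarith) (by linarith) hj0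
    have : 1 / (r0 * (r1 - 1)) < 1 / r1 := by
      apply one_div_lt_one_div_of_lt (by linarith)
      nlinarith
    linarith
  let S : Set ℝ := {t : ℝ | NG q0 q1 (q0 ^ (max t s)) (q1 ^ (max t s))} ∩ Set.Icc s T
  have hSc : IsCompact S := isCompact_Icc.inter_left hcl
  have hsS : s ∈ S := by
    have h' : NG q0 q1 (q0 ^ (max s s)) (q1 ^ (max s s)) := by rwa [max_self]
    exact ⟨h', le_rfl, hbd s h'⟩
  obtain ⟨u, ⟨hu, hus, huT⟩, hmax⟩ := hSc.exists_isGreatest ⟨s, hsS⟩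
  simp only [Set.mem_ofPred_eq, max_eq_left hus] at hu
  obtain ⟨a, b, ha, hb, ha0, hb0, hab⟩ := hu
  have hall : ∀ i ∈ V q0 q1, ∀ j ∈ V q0 q1, i 0 = false → j 0 = true →
      piE (q0 ^ u) (q1 ^ u) i ≤ piE (q0 ^ u) (q1 ^ u) j := by
    intro i hi j hj hi0 hj0
    have ci : Continuous fun t : ℝ => piE (q0 ^ (max t s)) (q1 ^ (max t s)) i :=
      piE_cont hκ cq0 cq1 continuous_const mq0 mq1
    have cj : Continuous fun t : ℝ => piE (q0 ^ (max t s)) (q1 ^ (max t s)) j :=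
      piE_cont hκ cq0 cq1 continuous_const mq0 mq1
    have li := (ci.tendsto u).mono_left (nhdsWithin_le_nhds (s := Set.Ioi u))
    have lj := (cj.tendsto u).mono_left (nhdsWithin_le_nhds (s := Set.Ioi u))
    rw [max_eq_left hus] at li lj
    refine le_of_tendsto_of_tendsto li lj ?_
    filter_upwards [self_mem_nhdsWithin] with t ht
    by_contra hlt
    push Not at hlt
    have hNG : NG q0 q1 (q0 ^ (max t s)) (q1 ^ (max t s)) := ⟨i, j, hi, hj, hi0, hj0, hlt.le⟩
    have : t ∈ S := ⟨hNG, hus.trans (le_of_lt ht), hbd t hNG⟩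
    have := hmax this
    exact absurd ht (not_lt.2 this)
  have heq : piE (q0 ^ u) (q1 ^ u) a = piE (q0 ^ u) (q1 ^ u) b :=
    le_antisymm (hall a ha b hb ha0 hb0) hab
  refine ⟨u, hus, a, ha, b, hb, _, ha0, hb0, rfl, heq.symm, fun i hi hi0 => ?_, fun i hi hi0 => ?_⟩
  · rw [heq]; exact hall i hi b hb hi0 hb0
  · exact hall a ha i hi ha0 hi0

/-- the gap is an open condition -/
theorem gap_open {q0 q1 s : ℝ} (h0 : 1 < q0) (h1 : 1 < q1) (hs : 0 < s)
    (h : ¬ NG q0 q1 (q0 ^ s) (q1 ^ s)) :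
    ∀ᶠ q : ℝ × ℝ in 𝓝 (q0, q1), ¬ NG q.1 q.2 (q.1 ^ s) (q.2 ^ s) := by
  obtain ⟨κ, hκ1, hκ⟩ := exists_between (lt_min h0 h1)
  have k0 : κ < q0 := hκ.trans_le (min_le_left _ _)
  have k1 : κ < q1 := hκ.trans_le (min_le_right _ _)
  have hl : 1 < min κ (κ ^ s) := lt_min hκ1 (Real.one_lt_rpow hκ1 hs)
  have c0 : Continuous fun q : ℝ × ℝ => max q.1 κ := continuous_fst.max continuous_const
  have c1 : Continuous fun q : ℝ × ℝ => max q.2 κ := continuous_snd.max continuous_const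
  have hpos : ∀ x : ℝ, 0 < max x κ := fun x => lt_max_of_lt_right (by linarith)
  have hcl : IsClosed {q : ℝ × ℝ | NG (max q.1 κ) (max q.2 κ) ((max q.1 κ) ^ s) ((max q.2 κ) ^ s)} := by
    refine closed_NG hl c0 c1
      (c0.rpow_const fun q => Or.inr hs.le) (c1.rpow_const fun q => Or.inr hs.le)
      (fun q => (min_le_left _ _).trans (le_max_right _ _))
      (fun q => (min_le_left _ _).trans (le_max_right _ _))
      (fun q => (min_le_right _ _).trans ?_) (fun q => (min_le_right _ _).trans ?_)
    · exact Real.rpow_le_rpow (by linarith) (le_max_right _ _) hs.le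
    · exact Real.rpow_le_rpow (by linarith) (le_max_right _ _) hs.le
  have hmem : (q0, q1) ∉ {q : ℝ × ℝ | NG (max q.1 κ) (max q.2 κ) ((max q.1 κ) ^ s) ((max q.2 κ) ^ s)} := by
    simp only [Set.mem_ofPred_eq, max_eq_left k0.le, max_eq_left k1.le]
    exact h
  have hev := hcl.isOpen_compl.mem_nhds hmem
  have e0 : ∀ᶠ q : ℝ × ℝ in 𝓝 (q0, q1), κ < q.1 := (continuous_fst.tendsto (q0, q1)).eventually (lt_mem_nhds k0)
  have e1 : ∀ᶠ q : ℝ × ℝ in 𝓝 (q0, q1), κ < q.2 := (continuous_snd.tendsto (q0, q1)).eventually (lt_mem_nhds k1)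
  filter_upwards [hev, e0, e1] with q hq a0 a1
  simp only [Set.mem_compl_iff, Set.mem_ofPred_eq, max_eq_left a0.le, max_eq_left a1.le] at hq
  exact hq


/-! ### Part 4: itineraries belong to `V` -/

def IT (p0 p1 c : ℝ) : Set (ℕ → Bool) :=
  {i | ∀ n, (i n = false → piE p0 p1 (shiftTail i n) < c) ∧
    (i n = true → c ≤ piE p0 p1 (shiftTail i n))}

theorem IT_shift {p0 p1 c : ℝ} {i : ℕ → Bool} (h : i ∈ IT p0 p1 c) (n : ℕ) :
    shiftTail i n ∈ IT p0 p1 c := by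
  intro m
  rw [shift_shift]
  exact h (n + m)

theorem IT_0 {p0 p1 c : ℝ} {i : ℕ → Bool} (h : i ∈ IT p0 p1 c) (h0 : i 0 = false) :
    piE p0 p1 i < c := by
  have := (h 0).1 h0
  rwa [shift_zero] at this

theorem IT_1 {p0 p1 c : ℝ} {i : ℕ → Bool} (h : i ∈ IT p0 p1 c) (h0 : i 0 = true) :
    c ≤ piE p0 p1 i := by
  have := (h 0).2 h0
  rwa [shift_zero] at this

structure Setup (q0 q1 p0 p1 c : ℝ) (a b : ℕ → Bool) : Prop where
  hq0 : 1 < q0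
  hq1 : 1 < q1
  hp0 : 1 < p0
  hp1 : 1 < p1
  ha : a ∈ V q0 q1
  hb : b ∈ V q0 q1
  ha0 : a 0 = false
  hb0 : b 0 = true
  hac : piE p0 p1 a = c
  hbc : piE p0 p1 b = c
  all0 : ∀ i ∈ V q0 q1, i 0 = false → piE p0 p1 i ≤ c
  all1 : ∀ i ∈ V q0 q1, i 0 = true → c ≤ piE p0 p1 i

theorem cmp0 {q0 q1 p0 p1 c : ℝ} {a b : ℕ → Bool} (S : Setup q0 q1 p0 p1 c a b) {j : ℕ → Bool}
    (hj : j ∈ IT p0 p1 c) (hj0 : j 0 = false) :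
    ∃ n, 1 ≤ n ∧ (∀ k < n, j k = a k) ∧ j n = false ∧ a n = true := by
  have hlt := IT_0 hj hj0
  have hne : j ≠ a := by
    rintro rfl
    rw [S.hac] at hlt; exact lt_irrefl _ hlt
  obtain ⟨n, hn, hd⟩ := first_diff hne
  have hn1 : 1 ≤ n := by
    rcases Nat.eq_zero_or_pos n with rfl | h
    · rw [hj0, S.ha0] at hd; exact absurd rfl hd
    · exact h
  have hdiff := piE_diff S.hp0 S.hp1 n j a hn
  have hneg : piE p0 p1 j - piE p0 p1 a < 0 := by rw [S.hac]; linarith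
  rw [hdiff] at hneg
  have hpos := inv_pos.2 (qb_prod_pos S.hp0 S.hp1 j n)
  have hneg' : piE p0 p1 (shiftTail j n) - piE p0 p1 (shiftTail a n) < 0 := by
    by_contra h
    push Not at h
    have := mul_nonneg hpos.le h
    linarith
  refine ⟨n, hn1, hn, ?_⟩
  cases hjn : j n
  · refine ⟨rfl, ?_⟩
    rw [hjn] at hd; revert hd; cases a n <;> simp
  · exfalso
    have han : a n = false := by rw [hjn] at hd; revert hd; cases a n <;> simp
    have e1 := (hj n).2 hjn
    have e2 := S.all0 _ (XS_shift S.ha n) (by rw [shift_at, han])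
    linarith

theorem cmp1 {q0 q1 p0 p1 c : ℝ} {a b : ℕ → Bool} (S : Setup q0 q1 p0 p1 c a b) {j : ℕ → Bool}
    (hj : j ∈ IT p0 p1 c) (hj0 : j 0 = true) :
    j = b ∨ ∃ n, 1 ≤ n ∧ (∀ k < n, j k = b k) ∧ j n = true ∧ b n = false := by
  by_cases hne : j = b
  · exact Or.inl hne
  right
  have hlt := IT_1 hj hj0
  obtain ⟨n, hn, hd⟩ := first_diff hne
  have hn1 : 1 ≤ n := by
    rcases Nat.eq_zero_or_pos n with rfl | h
    · rw [hj0, S.hb0] at hd; exact absurd rfl hd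
    · exact h
  have hdiff := piE_diff S.hp0 S.hp1 n j b hn
  have hneg : 0 ≤ piE p0 p1 j - piE p0 p1 b := by rw [S.hbc]; linarith
  rw [hdiff] at hneg
  have hpos := inv_pos.2 (qb_prod_pos S.hp0 S.hp1 j n)
  have hneg' : 0 ≤ piE p0 p1 (shiftTail j n) - piE p0 p1 (shiftTail b n) :=
    nonneg_of_mul_nonneg_right hneg hpos
  refine ⟨n, hn1, hn, ?_⟩
  cases hjn : j n
  · exfalso
    have han : b n = true := by rw [hjn] at hd; revert hd; cases b n <;> simp
    have e1 := (hj n).1 hjn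
    have e2 := S.all1 _ (XS_shift S.hb n) (by rw [shift_at, han])
    linarith
  · refine ⟨rfl, ?_⟩
    rw [hjn] at hd; revert hd; cases b n <;> simp

theorem prod_inv_le {q0 q1 : ℝ} (h0 : 1 < q0) (h1 : 1 < q1) (i : ℕ → Bool) {n : ℕ} (hn : 1 ≤ n) :
    (∏ k ∈ Finset.range n, qb q0 q1 (i k))⁻¹ ≤ (min q0 q1)⁻¹ := by
  have hκ : 1 < min q0 q1 := lt_min h0 h1
  apply inv_anti₀ (by linarith)
  have := qb_prod_ge hκ (min_le_left _ _) (min_le_right _ _) i n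
  refine le_trans ?_ this
  exact le_self_pow₀ hκ.le (by omega)

theorem IT_sub_V {q0 q1 p0 p1 c : ℝ} {a b : ℕ → Bool} (S : Setup q0 q1 p0 p1 c a b)
    (hAB : 1 / q1 ≤ 1 / (q0 * (q1 - 1))) {j : ℕ → Bool} (hj : j ∈ IT p0 p1 c) : j ∈ V q0 q1 := by
  have hκ : 1 < min q0 q1 := lt_min S.hq0 S.hq1
  have hk1 : (min q0 q1)⁻¹ < 1 := inv_lt_one_of_one_lt₀ hκ
  have hk0 : 0 < (min q0 q1)⁻¹ := by positivity
  have hm := mpos S.hq1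
  have hq0 := S.hq0
  have hq1 := S.hq1
  set A := 1 / q1 with hA
  set B := 1 / (q0 * (q1 - 1)) with hB
  have hA0 : 0 < A := by positivity
  have hBm : B ≤ 1 / (q1 - 1) := by
    rw [hB, mul_comm, ← div_div]
    exact (div_lt_self hm S.hq0).le
  set C := 1 / (q1 - 1) with hC
  set κ := (min q0 q1)⁻¹ with hκd
  have key : ∀ K : ℕ, ∀ j ∈ IT p0 p1 c, (j 0 = false → piE q0 q1 j - A ≤ C * κ ^ K) ∧
      (j 0 = true → B - piE q0 q1 j ≤ C * κ ^ K) := by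
    intro K
    induction K with
    | zero =>
      intro j hj
      have e1 := piE_nonneg hq0 hq1 j
      have e2 := piE_le hq0 hq1 j
      rw [pow_zero, mul_one]
      exact ⟨fun _ => by linarith, fun _ => by linarith⟩
    | succ K ih =>
      intro j hj
      have hCK : 0 ≤ C * κ ^ K := by positivity
      constructor
      · intro hj0
        obtain ⟨n, hn1, hn, hjn, han⟩ := cmp0 S hj hj0
        have e1 := piE_diff hq0 hq1 n j a hn
        have e2 := (ih _ (IT_shift hj n)).1 (by rw [shift_at, hjn])
        have e3 := XS_1 (XS_shift S.ha n) (by rw [shift_at, han])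
        have e4 := XS_0 S.ha S.ha0
        have hpos := inv_pos.2 (qb_prod_pos hq0 hq1 j n)
        have hle := prod_inv_le hq0 hq1 j hn1
        set P := (∏ k ∈ Finset.range n, qb q0 q1 (j k))⁻¹
        have e5 : P * (piE q0 q1 (shiftTail j n) - piE q0 q1 (shiftTail a n)) ≤ P * (C * κ ^ K) := by
          refine mul_le_mul_of_nonneg_left ?_ hpos.le
          linarith
        have e6 : P * (C * κ ^ K) ≤ κ * (C * κ ^ K) := by gcongr
        have e7 : κ * (C * κ ^ K) = C * κ ^ (K + 1) := by ring
        linarith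
      · intro hj0
        rcases cmp1 S hj hj0 with rfl | ⟨n, hn1, hn, hjn, han⟩
        · have e4 := XS_1 S.hb S.hb0
          have : 0 ≤ C * κ ^ (K + 1) := by positivity
          linarith
        have e1 := piE_diff hq0 hq1 n j b hn
        have e2 := (ih _ (IT_shift hj n)).2 (by rw [shift_at, hjn])
        have e3 := XS_0 (XS_shift S.hb n) (by rw [shift_at, han])
        have e4 := XS_1 S.hb S.hb0
        have hpos := inv_pos.2 (qb_prod_pos hq0 hq1 j n)
        have hle := prod_inv_le hq0 hq1 j hn1
        set P := (∏ k ∈ Finset.range n, qb q0 q1 (j k))⁻¹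
        have e5 : P * (piE q0 q1 (shiftTail b n) - piE q0 q1 (shiftTail j n)) ≤ P * (C * κ ^ K) := by
          refine mul_le_mul_of_nonneg_left ?_ hpos.le
          linarith
        have e6 : P * (C * κ ^ K) ≤ κ * (C * κ ^ K) := by gcongr
        have e7 : κ * (C * κ ^ K) = C * κ ^ (K + 1) := by ring
        linarith
  intro n
  constructor
  · intro hn
    have := le_zero_of_contr hk0.le hk1
      (fun K => (key K _ (IT_shift hj n)).1 (by rw [shift_at, hn]))
    linarith
  · intro hn
    have := le_zero_of_contr hk0.le hk1
      (fun K => (key K _ (IT_shift hj n)).2 (by rw [shift_at, hn]))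
    linarith

theorem IT_sub_V' {q0 q1 p0 p1 c : ℝ} {a b : ℕ → Bool} (S : Setup q0 q1 p0 p1 c a b)
    {j : ℕ → Bool} (hj : j ∈ IT p0 p1 c) : j ∈ V q0 q1 := by
  rcases le_total (1 / q1) (1 / (q0 * (q1 - 1))) with h | h
  · exact IT_sub_V S h hj
  · exact V_univ S.hq0 S.hq1 h j

theorem Setup.c_ge {q0 q1 p0 p1 c : ℝ} {a b : ℕ → Bool} (S : Setup q0 q1 p0 p1 c a b) :
    1 / p1 ≤ c := by
  have := piE_ge1 S.hp0 S.hp1 S.hb0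
  rwa [S.hbc] at this

theorem Setup.c_le {q0 q1 p0 p1 c : ℝ} {a b : ℕ → Bool} (S : Setup q0 q1 p0 p1 c a b) :
    c ≤ 1 / (p0 * (p1 - 1)) := by
  have := piE_le0 S.hp0 S.hp1 S.ha0
  rwa [S.hac] at this

theorem dimH_full {p0 p1 c : ℝ} (hp0 : 1 < p0) (hp1 : 1 < p1) (hc1 : 1 / p1 ≤ c)
    (hc0 : c ≤ 1 / (p0 * (p1 - 1))) {X : Set (ℕ → Bool)} (hX : ∀ j ∈ IT p0 p1 c, j ∈ X) :
    1 ≤ dimH (piE p0 p1 '' X) := by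
  have hsub : Set.Icc 0 (1 / (p1 - 1)) ⊆ piE p0 p1 '' X := by
    rintro x ⟨hx0, hx1⟩
    obtain ⟨i, hi, hi2⟩ := itin hp0 hp1 hc1 hc0 hx0 hx1
    exact ⟨i, hX i hi2, hi⟩
  refine le_trans ?_ (dimH_mono hsub)
  have hne : (interior (Set.Icc 0 (1 / (p1 - 1)))).Nonempty := by
    rw [interior_Icc]
    exact Set.nonempty_Ioo.2 (mpos hp1)
  rw [Real.dimH_of_nonempty_interior hne]
  simp

/-- Theorem A -/
theorem ng_dim {q0 q1 s : ℝ} (h0 : 1 < q0) (h1 : 1 < q1) (hs : 0 < s)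
    (h : NG q0 q1 (q0 ^ s) (q1 ^ s)) : ENNReal.ofReal s ≤ dimH (univoque q0 q1) := by
  obtain ⟨u, hus, a, ha, b, hb, c, ha0, hb0, hac, hbc, all0, all1⟩ := crit h0 h1 hs h
  have hu : 0 < u := hs.trans_le hus
  have S : Setup q0 q1 (q0 ^ u) (q1 ^ u) c a b :=
    ⟨h0, h1, Real.one_lt_rpow h0 hu, Real.one_lt_rpow h1 hu, ha, hb, ha0, hb0, hac, hbc, all0, all1⟩
  refine (ENNReal.ofReal_le_ofReal hus).trans ?_
  rw [dimH_univoque h0 h1]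
  have hfull : 1 ≤ dimH (piE (q0 ^ u) (q1 ^ u) '' V q0 q1) :=
    dimH_full S.hp0 S.hp1 S.c_ge S.c_le fun j hj => IT_sub_V' S hj
  by_cases hAB : 1 / q1 = 1 / (q0 * (q1 - 1))
  · have h1d : 1 ≤ dimH (piE q0 q1 '' V q0 q1) :=
      dimH_full h0 h1 (c := 1 / q1) le_rfl hAB.le fun j _ => V_univ h0 h1 hAB.ge j
    refine le_trans ?_ h1d
    rw [← ENNReal.ofReal_one]
    apply ENNReal.ofReal_le_ofReal
    by_contra hlt
    push Not at hlt
    have hcc := S.c_ge.trans S.c_le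
    have p0 : 0 < q0 := by linarith
    have p1 : 0 < q1 := by linarith
    have pm : 0 < q1 - 1 := by linarith
    have k1 : 1 < q1 ^ u := S.hp1
    have k0 : 1 < q0 ^ u := S.hp0
    have pm' : 0 < q1 ^ u - 1 := by linarith
    rw [one_div_le_one_div (by positivity) (by positivity)] at hcc
    have hE : q1 = q0 * (q1 - 1) := by
      have := one_div_div 1 q1
      field_simp at hAB
      linarith
    -- 1/q0 + 1/q1 = 1
    have hE2 : q0⁻¹ + q1⁻¹ = 1 := by field_simp; linarith
    have f0 : (q0 ^ u)⁻¹ < q0⁻¹ := by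
      apply inv_strictAnti₀ p0
      nth_rewrite 1 [← Real.rpow_one q0]
      exact Real.rpow_lt_rpow_of_exponent_lt h0 hlt
    have f1 : (q1 ^ u)⁻¹ < q1⁻¹ := by
      apply inv_strictAnti₀ p1
      nth_rewrite 1 [← Real.rpow_one q1]
      exact Real.rpow_lt_rpow_of_exponent_lt h1 hlt
    have f2 : 1 ≤ (q0 ^ u)⁻¹ + (q1 ^ u)⁻¹ := by
      have z0 : 0 < q0 ^ u := by linarith
      have z1 : 0 < q1 ^ u := by linarith
      rw [inv_add_inv z0.ne' z1.ne', le_div_iff₀ (by positivity)]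
      linarith
    linarith
  · have hg : 0 < |1 / q1 - 1 / (q0 * (q1 - 1))| := abs_pos.2 (sub_ne_zero.2 hAB)
    have := holder_cmp h0 h1 S.hp0 S.hp1 hu hg le_rfl le_rfl (V q0 q1) (fun i hi n => XS_shift hi n)
      (by
        intro i hi j hj hi0 hj0
        have a1 := XS_0 hi hi0
        have a2 := XS_1 hj hj0
        have a3 := piE_le0 h0 h1 hi0
        have a4 := piE_ge1 h0 h1 hj0
        rcases abs_cases (1 / q1 - 1 / (q0 * (q1 - 1))) with ⟨e, _⟩ | ⟨e, _⟩ <;> rw [e] <;> linarith)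
    have h3 := hfull.trans this
    rw [ENNReal.le_div_iff_mul_le (Or.inl (ENNReal.ofReal_pos.2 hu).ne') (Or.inl ENNReal.ofReal_ne_top),
      one_mul] at h3
    exact h3

/-- strictly separated itineraries stay in `V` after perturbation -/
theorem SS_strict {q0 q1 p0 p1 c ε : ℝ} {a b : ℕ → Bool} (S : Setup q0 q1 p0 p1 c a b)
    (hε : 0 < ε) {j : ℕ → Bool} (hj : j ∈ XS p0 p1 (c - ε) (c + ε)) :
    (j 0 = false → piE q0 q1 j < 1 / q1) ∧ (j 0 = true → 1 / (q0 * (q1 - 1)) < piE q0 q1 j) := by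
  have hIT : ∀ j ∈ XS p0 p1 (c - ε) (c + ε), j ∈ IT p0 p1 c := by
    intro j hj n
    have := hj n
    exact ⟨fun h => by have := this.1 h; linarith, fun h => by have := this.2 h; linarith⟩
  have hq0 := S.hq0
  have hq1 := S.hq1
  have hp0 := S.hp0
  have hp1 := S.hp1
  rcases lt_or_ge (1 / (q0 * (q1 - 1))) (1 / q1) with hAB | hAB
  · exact ⟨fun h => (piE_le0 hq0 hq1 h).trans_lt hAB, fun h => hAB.trans_le (piE_ge1 hq0 hq1 h)⟩
  · constructor
    · intro hj0
      obtain ⟨n, hn1, hn, hjn, han⟩ := cmp0 S (hIT j hj) hj0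
      have hjn0 : shiftTail j n 0 = false := by rw [shift_at, hjn]
      have e1 := piE_diff hq0 hq1 n j a hn
      have e2 := XS_0 (IT_sub_V S hAB (IT_shift (hIT j hj) n)) hjn0
      have e3 := XS_1 (XS_shift S.ha n) (by rw [shift_at, han])
      have e4 := XS_0 S.ha S.ha0
      have hpos := inv_pos.2 (qb_prod_pos hq0 hq1 j n)
      have hstrict : piE q0 q1 (shiftTail j n) < piE q0 q1 (shiftTail a n) := by
        by_contra hge
        push Not at hge
        have hB : piE q0 q1 (shiftTail j n) = 1 / (q0 * (q1 - 1)) :=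
          le_antisymm (piE_le0 hq0 hq1 hjn0) (by linarith)
        rw [piE_rec0 hq0 hq1 hjn0, mul_comm, ← div_div, div_left_inj' (by linarith)] at hB
        have := eq_ones hq0 hq1 _ hB
        have h5 := piE_rec0 hp0 hp1 hjn0
        rw [this, piE_ones hp0 hp1, div_div, mul_comm] at h5
        have h6 := (hj n).1 hjn
        have := S.c_le
        linarith
      have := mul_neg_of_pos_of_neg hpos (sub_neg.2 hstrict)
      linarith
    · intro hj0
      rcases cmp1 S (hIT j hj) hj0 with rfl | ⟨n, hn1, hn, hjn, han⟩
      · have := XS_1 hj hj0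
        rw [S.hbc] at this
        linarith
      have hjn0 : shiftTail j n 0 = true := by rw [shift_at, hjn]
      have e1 := piE_diff hq0 hq1 n j b hn
      have e2 := XS_1 (IT_sub_V S hAB (IT_shift (hIT j hj) n)) hjn0
      have e3 := XS_0 (XS_shift S.hb n) (by rw [shift_at, han])
      have e4 := XS_1 S.hb S.hb0
      have hpos := inv_pos.2 (qb_prod_pos hq0 hq1 j n)
      have hstrict : piE q0 q1 (shiftTail b n) < piE q0 q1 (shiftTail j n) := by
        by_contra hge
        push Not at hge
        have hB : piE q0 q1 (shiftTail j n) = 1 / q1 :=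
          le_antisymm (by linarith) (piE_ge1 hq0 hq1 hjn0)
        rw [piE_rec1 hq0 hq1 hjn0, div_left_inj' (by linarith)] at hB
        have := eq_zeros hq0 hq1 _ (by linarith : piE q0 q1 (shiftTail (shiftTail j n) 1) = 0)
        have h5 := piE_rec1 hp0 hp1 hjn0
        rw [this, piE_zeros, add_zero] at h5
        have h6 := (hj n).2 hjn
        have := S.c_ge
        linarith
      have := mul_pos hpos (sub_pos.2 hstrict)
      linarith

theorem SS_sub_V {q0 q1 p0 p1 c ε : ℝ} {a b : ℕ → Bool} (S : Setup q0 q1 p0 p1 c a b)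
    (hε : 0 < ε) : ∀ᶠ q : ℝ × ℝ in 𝓝 (q0, q1), XS p0 p1 (c - ε) (c + ε) ⊆ V q.1 q.2 := by
  obtain ⟨κ, hκ1, hκ⟩ := exists_between (lt_min S.hq0 S.hq1)
  have k0 : κ < q0 := hκ.trans_le (min_le_left _ _)
  have k1 : κ < q1 := hκ.trans_le (min_le_right _ _)
  have c0 : Continuous fun z : (ℝ × ℝ) × (ℕ → Bool) => max z.1.1 κ :=
    (continuous_fst.comp continuous_fst).max continuous_const
  have c1 : Continuous fun z : (ℝ × ℝ) × (ℕ → Bool) => max z.1.2 κ :=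
    (continuous_snd.comp continuous_fst).max continuous_const
  have hpos : ∀ x : ℝ, 1 < max x κ := fun x => lt_max_of_lt_right (by linarith)
  have hπ : Continuous fun z : (ℝ × ℝ) × (ℕ → Bool) => piE (max z.1.1 κ) (max z.1.2 κ) z.2 :=
    piE_cont hκ1 c0 c1 continuous_snd (fun _ => le_max_right _ _) (fun _ => le_max_right _ _)
  have hX : IsClosed {z : (ℝ × ℝ) × (ℕ → Bool) | z.2 ∈ XS p0 p1 (c - ε) (c + ε)} :=
    closed_XS (lt_min S.hp0 S.hp1) continuous_const continuous_const continuous_snd continuous_const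
      continuous_const (fun _ => min_le_left _ _) (fun _ => min_le_right _ _)
  let B0 : Set ((ℝ × ℝ) × (ℕ → Bool)) := {z | z.2 ∈ XS p0 p1 (c - ε) (c + ε)} ∩ ({z | z.2 0 = false} ∩
    {z | 1 / max z.1.2 κ ≤ piE (max z.1.1 κ) (max z.1.2 κ) z.2})
  let B1 : Set ((ℝ × ℝ) × (ℕ → Bool)) := {z | z.2 ∈ XS p0 p1 (c - ε) (c + ε)} ∩ ({z | z.2 0 = true} ∩
    {z | piE (max z.1.1 κ) (max z.1.2 κ) z.2 ≤ 1 / (max z.1.1 κ * (max z.1.2 κ - 1))})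
  have hB0 : IsClosed B0 := by
    refine hX.inter (IsClosed.inter (closed_digit continuous_snd 0 false).isClosed (isClosed_le ?_ hπ))
    exact continuous_const.div c1 fun z => by have := hpos z.1.2; linarith
  have hB1 : IsClosed B1 := by
    refine hX.inter (IsClosed.inter (closed_digit continuous_snd 0 true).isClosed (isClosed_le hπ ?_))
    refine continuous_const.div (c0.mul (c1.sub continuous_const)) fun z => ?_
    have a0 := hpos z.1.1
    have a1 := hpos z.1.2
    exact (mul_pos (by linarith) (by linarith)).ne'
  have hn0 : (q0, q1) ∉ Prod.fst '' B0 := by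
    rintro ⟨⟨q, i⟩, ⟨hi, hi0, hle⟩, rfl⟩
    have := (SS_strict S hε hi).1 hi0
    simp only [Set.mem_ofPred_eq, max_eq_left k0.le, max_eq_left k1.le] at hle
    linarith
  have hn1 : (q0, q1) ∉ Prod.fst '' B1 := by
    rintro ⟨⟨q, i⟩, ⟨hi, hi0, hle⟩, rfl⟩
    have := (SS_strict S hε hi).2 hi0
    simp only [Set.mem_ofPred_eq, max_eq_left k0.le, max_eq_left k1.le] at hle
    linarith
  have ev0 := (isClosedMap_fst_of_compactSpace _ hB0).isOpen_compl.mem_nhds hn0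
  have ev1 := (isClosedMap_fst_of_compactSpace _ hB1).isOpen_compl.mem_nhds hn1
  have e0 : ∀ᶠ q : ℝ × ℝ in 𝓝 (q0, q1), κ < q.1 := (continuous_fst.tendsto (q0, q1)).eventually (lt_mem_nhds k0)
  have e1 : ∀ᶠ q : ℝ × ℝ in 𝓝 (q0, q1), κ < q.2 := (continuous_snd.tendsto (q0, q1)).eventually (lt_mem_nhds k1)
  filter_upwards [ev0, ev1, e0, e1] with q hq0 hq1 a0 a1 i hi n
  have hin := XS_shift hi n
  constructor
  · intro h
    by_contra hlt
    push Not at hlt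
    refine hq0 ⟨(q, shiftTail i n), ⟨hin, by show shiftTail i n 0 = false; rw [shift_at, h], ?_⟩, rfl⟩
    simp only [Set.mem_ofPred_eq, max_eq_left a0.le, max_eq_left a1.le]
    exact hlt.le
  · intro h
    by_contra hlt
    push Not at hlt
    refine hq1 ⟨(q, shiftTail i n), ⟨hin, by show shiftTail i n 0 = true; rw [shift_at, h], ?_⟩, rfl⟩
    simp only [Set.mem_ofPred_eq, max_eq_left a0.le, max_eq_left a1.le]
    exact hlt.le


/-! ### Part 5: growth of the trimmed interval map -/

/-- weighted transfer operator of the trimmed interval dynamics -/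
noncomputable def tr (p0 p1 c ε a0 a1 : ℝ) (F : ℝ → ℝ → ℝ) : ℕ → ℝ → ℝ → ℝ
  | 0 => F
  | n + 1 => fun x y => if x ≤ y then
      a0 * tr p0 p1 c ε a0 a1 F n (p0 * x) (p0 * min y (c - ε)) +
      a1 * tr p0 p1 c ε a0 a1 F n (p1 * max x (c + ε) - 1) (p1 * y - 1) else 0

noncomputable def len (x y : ℝ) : ℝ := max (y - x) 0
noncomputable def one (x y : ℝ) : ℝ := if x ≤ y then 1 else 0
noncomputable def lng (η x y : ℝ) : ℝ := if η ≤ y - x then 1 else 0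

/-- standing assumptions -/
structure Par (p0 p1 c : ℝ) : Prop where
  h0 : 1 < p0
  h1 : 1 < p1
  hc1 : 1 / p1 ≤ c
  hc0 : c ≤ 1 / (p0 * (p1 - 1))

section
variable {p0 p1 c ε a0 a1 : ℝ}

theorem Par.c1 (P : Par p0 p1 c) : 0 ≤ p1 * c - 1 := by
  have h1 := P.h1
  have := P.hc1
  rw [div_le_iff₀ (by linarith)] at this
  linarith

theorem Par.c0 (P : Par p0 p1 c) : p0 * c ≤ 1 / (p1 - 1) := by
  have h0 := P.h0
  have h1 := P.h1
  have := P.hc0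
  rw [← div_div, div_right_comm, le_div_iff₀ (by linarith)] at this
  linarith

theorem Par.mm (P : Par p0 p1 c) : p1 * (1 / (p1 - 1)) - 1 = 1 / (p1 - 1) := by
  have h1 := P.h1
  have : p1 - 1 ≠ 0 := by linarith
  field_simp
  ring

/-- range preservation -/
theorem Par.rangeL (P : Par p0 p1 c) (hε : 0 < ε) {x : ℝ} (y : ℝ) (hx : 0 ≤ x) :
    0 ≤ p0 * x ∧ p0 * min y (c - ε) ≤ 1 / (p1 - 1) := by
  have h0 := P.h0
  refine ⟨by positivity, le_trans ?_ P.c0⟩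
  have : min y (c - ε) ≤ c := (min_le_right _ _).trans (by linarith)
  gcongr

theorem Par.rangeR (P : Par p0 p1 c) (hε : 0 < ε) (x : ℝ) {y : ℝ} (hy : y ≤ 1 / (p1 - 1)) :
    0 ≤ p1 * max x (c + ε) - 1 ∧ p1 * y - 1 ≤ 1 / (p1 - 1) := by
  have h1 := P.h1
  constructor
  · refine P.c1.trans ?_
    have : c ≤ max x (c + ε) := le_trans (by linarith) (le_max_right _ _)
    gcongr
  · rw [← P.mm]; gcongr

theorem tr_mono (P : Par p0 p1 c) (hε : 0 < ε) (ha0 : 0 ≤ a0) (ha1 : 0 ≤ a1) {F G : ℝ → ℝ → ℝ}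
    (h : ∀ x y, 0 ≤ x → y ≤ 1 / (p1 - 1) → F x y ≤ G x y) (n : ℕ) :
    ∀ x y, 0 ≤ x → y ≤ 1 / (p1 - 1) → tr p0 p1 c ε a0 a1 F n x y ≤ tr p0 p1 c ε a0 a1 G n x y := by
  induction n with
  | zero => exact h
  | succ n ih =>
    intro x y hx hy
    simp only [tr]
    split_ifs
    · obtain ⟨l1, l2⟩ := P.rangeL hε y hx
      obtain ⟨r1, r2⟩ := P.rangeR hε x hy
      have := ih _ _ l1 l2
      have := ih _ _ r1 r2
      gcongr
    · exact le_rfl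

theorem tr_lin (F G : ℝ → ℝ → ℝ) (s t : ℝ) (n : ℕ) : ∀ x y,
    tr p0 p1 c ε a0 a1 (fun x y => s * F x y + t * G x y) n x y =
      s * tr p0 p1 c ε a0 a1 F n x y + t * tr p0 p1 c ε a0 a1 G n x y := by
  induction n with
  | zero => intro x y; rfl
  | succ n ih =>
    intro x y
    simp only [tr]
    split_ifs
    · rw [ih, ih]; ring
    · ring

theorem tr_smul (F : ℝ → ℝ → ℝ) (s : ℝ) (n : ℕ) (x y : ℝ) :
    tr p0 p1 c ε a0 a1 (fun x y => s * F x y) n x y = s * tr p0 p1 c ε a0 a1 F n x y := by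
  have := tr_lin (p0 := p0) (p1 := p1) (c := c) (ε := ε) (a0 := a0) (a1 := a1) F F s 0 n x y
  simpa using this

theorem tr_add (F : ℝ → ℝ → ℝ) (m n : ℕ) :
    tr p0 p1 c ε a0 a1 F (n + m) = tr p0 p1 c ε a0 a1 (tr p0 p1 c ε a0 a1 F m) n := by
  induction n with
  | zero => simp [tr]
  | succ n ih =>
    rw [Nat.succ_add]
    simp only [tr]
    rw [ih]

theorem tr_null {F : ℝ → ℝ → ℝ} (h : ∀ x y, y < x → F x y = 0) (n : ℕ) {x y : ℝ} (hxy : y < x) :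
    tr p0 p1 c ε a0 a1 F n x y = 0 := by
  cases n with
  | zero => exact h x y hxy
  | succ n => simp only [tr]; rw [if_neg (not_le.2 hxy)]

theorem tr_nonneg (ha0 : 0 ≤ a0) (ha1 : 0 ≤ a1) {F : ℝ → ℝ → ℝ} (h : ∀ x y, 0 ≤ F x y) (n : ℕ) :
    ∀ x y, 0 ≤ tr p0 p1 c ε a0 a1 F n x y := by
  induction n with
  | zero => exact h
  | succ n ih =>
    intro x y
    simp only [tr]
    split_ifs
    · have := ih (p0 * x) (p0 * min y (c - ε))
      have := ih (p1 * max x (c + ε) - 1) (p1 * y - 1)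
      positivity
    · exact le_rfl

theorem tr_weight {b0 b1 ω : ℝ} (ha0 : 0 ≤ a0) (ha1 : 0 ≤ a1) (hω : 0 ≤ ω) (hb0 : ω * a0 ≤ b0)
    (hb1 : ω * a1 ≤ b1) {F : ℝ → ℝ → ℝ} (h : ∀ x y, 0 ≤ F x y) (n : ℕ) :
    ∀ x y, ω ^ n * tr p0 p1 c ε a0 a1 F n x y ≤ tr p0 p1 c ε b0 b1 F n x y := by
  induction n with
  | zero => intro x y; simp [tr]
  | succ n ih =>
    intro x y
    simp only [tr]
    split_ifs
    · have e1 := ih (p0 * x) (p0 * min y (c - ε))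
      have e2 := ih (p1 * max x (c + ε) - 1) (p1 * y - 1)
      have n1 := tr_nonneg (p0 := p0) (p1 := p1) (c := c) (ε := ε) ha0 ha1 h n (p0 * x) (p0 * min y (c - ε))
      have n2 := tr_nonneg (p0 := p0) (p1 := p1) (c := c) (ε := ε) ha0 ha1 h n (p1 * max x (c + ε) - 1) (p1 * y - 1)
      set A := tr p0 p1 c ε a0 a1 F n (p0 * x) (p0 * min y (c - ε))
      set B := tr p0 p1 c ε a0 a1 F n (p1 * max x (c + ε) - 1) (p1 * y - 1)
      have q0 : 0 ≤ ω * a0 := by positivity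
      have q1 : 0 ≤ ω * a1 := by positivity
      calc ω ^ (n + 1) * (a0 * A + a1 * B) = (ω * a0) * (ω ^ n * A) + (ω * a1) * (ω ^ n * B) := by ring
        _ ≤ _ := add_le_add (mul_le_mul hb0 e1 (by positivity) (q0.trans hb0))
              (mul_le_mul hb1 e2 (by positivity) (q1.trans hb1))
    · simp

theorem len_nonneg (x y : ℝ) : 0 ≤ len x y := le_max_right _ _
theorem one_nonneg (x y : ℝ) : 0 ≤ one x y := by unfold one; split_ifs <;> norm_num
theorem lng_nonneg (η x y : ℝ) : 0 ≤ lng η x y := by unfold lng; split_ifs <;> norm_num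
theorem one_null (x y : ℝ) (h : y < x) : one x y = 0 := by unfold one; rw [if_neg (not_le.2 h)]
theorem len_null (x y : ℝ) (h : y < x) : len x y = 0 := max_eq_right (by linarith)
theorem one_le (x y : ℝ) : one x y ≤ 1 := by unfold one; split_ifs <;> norm_num

theorem len_step (P : Par p0 p1 c) (hε : 0 < ε) {x y : ℝ} (hxy : x ≤ y) :
    p0⁻¹ * len (p0 * x) (p0 * min y (c - ε)) + p1⁻¹ * len (p1 * max x (c + ε) - 1) (p1 * y - 1) ≤ len x y
    ∧ len x y - 2 * ε ≤
    p0⁻¹ * len (p0 * x) (p0 * min y (c - ε)) + p1⁻¹ * len (p1 * max x (c + ε) - 1) (p1 * y - 1) := by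
  have h0 : 0 < p0 := by linarith [P.h0]
  have h1 : 0 < p1 := by linarith [P.h1]
  have e0 : p0⁻¹ * len (p0 * x) (p0 * min y (c - ε)) = len x (min y (c - ε)) := by
    unfold len
    rw [mul_max_of_nonneg _ _ (by positivity), ← mul_sub, inv_mul_cancel_left₀ h0.ne', mul_zero]
  have e1 : p1⁻¹ * len (p1 * max x (c + ε) - 1) (p1 * y - 1) = len (max x (c + ε)) y := by
    unfold len
    rw [mul_max_of_nonneg _ _ (by positivity), sub_sub_sub_cancel_right, ← mul_sub,
      inv_mul_cancel_left₀ h1.ne', mul_zero]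
  rw [e0, e1]
  unfold len
  constructor <;> rcases le_total y (c - ε) with h | h <;> rcases le_total x (c + ε) with h' | h' <;>
    simp only [h, h', min_eq_left, min_eq_right, max_eq_left, max_eq_right, sub_nonneg, hxy] <;>
    (try rcases max_cases (c - ε - x) 0 with ⟨u, u'⟩ | ⟨u, u'⟩) <;>
    (try rcases max_cases (y - (c + ε)) 0 with ⟨v, v'⟩ | ⟨v, v'⟩) <;>
    (try rw [u]) <;> (try rw [v]) <;> linarith

theorem tr_len_le (P : Par p0 p1 c) (hε : 0 < ε) (n : ℕ) : ∀ x y,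
    tr p0 p1 c ε p0⁻¹ p1⁻¹ len n x y ≤ len x y := by
  have h0 : 0 < p0⁻¹ := by have := P.h0; positivity
  have h1 : 0 < p1⁻¹ := by have := P.h1; positivity
  induction n with
  | zero => intro x y; exact le_rfl
  | succ n ih =>
    intro x y
    simp only [tr]
    split_ifs with h
    · refine le_trans ?_ (len_step P hε h).1
      have := ih (p0 * x) (p0 * min y (c - ε))
      have := ih (p1 * max x (c + ε) - 1) (p1 * y - 1)
      gcongr
    · exact len_nonneg _ _

theorem tr_len_ge (P : Par p0 p1 c) (hε : 0 < ε) (n : ℕ) : ∀ x y,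
    len x y - 2 * ε * (2 ^ n - 1) ≤ tr p0 p1 c ε p0⁻¹ p1⁻¹ len n x y := by
  have h0 : 0 < p0⁻¹ := by have := P.h0; positivity
  have h1 : 0 < p1⁻¹ := by have := P.h1; positivity
  have h0' : p0⁻¹ ≤ 1 := inv_le_one_of_one_le₀ P.h0.le
  have h1' : p1⁻¹ ≤ 1 := inv_le_one_of_one_le₀ P.h1.le
  induction n with
  | zero => intro x y; simp [tr]
  | succ n ih =>
    intro x y
    have hE : (0:ℝ) ≤ 2 * ε * (2 ^ n - 1) := by
      have : (1:ℝ) ≤ 2 ^ n := one_le_pow₀ (by norm_num)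
      have : (0:ℝ) ≤ 2 ^ n - 1 := by linarith
      positivity
    simp only [tr]
    split_ifs with h
    · have s := (len_step P hε h).2
      have i1 := mul_le_mul_of_nonneg_left (ih (p0 * x) (p0 * min y (c - ε))) h0.le
      have i2 := mul_le_mul_of_nonneg_left (ih (p1 * max x (c + ε) - 1) (p1 * y - 1)) h1.le
      have j1 := mul_le_mul_of_nonneg_right h0' hE
      have j2 := mul_le_mul_of_nonneg_right h1' hE
      rw [pow_succ]
      nlinarith
    · rw [len_null _ _ (not_le.1 h)]
      rw [pow_succ]
      nlinarith

/-- one-sided thin intervals -/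
theorem thin_left (P : Par p0 p1 c) {κ : ℝ} (ha0 : 0 ≤ a0) (ha1 : 0 ≤ a1) (hk0 : a0 ≤ κ) (hk1 : a1 ≤ κ)
    (n : ℕ) : ∀ l : ℝ, ∃ η > 0, ∀ ε > 0, ∀ x y, ε ≤ l - y → l - x < η →
      tr p0 p1 c ε a0 a1 one n x y ≤ κ ^ n := by
  have hp0 := P.h0
  have hp1 := P.h1
  have hκ : 0 ≤ κ := ha0.trans hk0
  induction n with
  | zero => intro l; exact ⟨1, one_pos, fun ε _ x y _ _ => by simpa [tr] using one_le x y⟩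
  | succ n ih =>
    intro l
    rcases le_or_gt l c with hl | hl
    · obtain ⟨η, hη, H⟩ := ih (p0 * l)
      refine ⟨η / p0, by positivity, fun ε hε x y h1 h2 => ?_⟩
      simp only [tr]
      split_ifs with hxy
      · rw [tr_null one_null n (x := p1 * max x (c + ε) - 1), mul_zero, add_zero, pow_succ, mul_comm]
        · rw [min_eq_left (by linarith)]
          rw [lt_div_iff₀ (by linarith)] at h2
          have := H ε hε (p0 * x) (p0 * y) (by nlinarith) (by linarith)
          have := tr_nonneg (p0 := p0) (p1 := p1) (c := c) (ε := ε) ha0 ha1 one_nonneg n (p0 * x) (p0 * y)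
          gcongr
        · have : y < max x (c + ε) := lt_of_lt_of_le (by linarith) (le_max_right _ _)
          gcongr
      · positivity
    · obtain ⟨η, hη, H⟩ := ih (p1 * l - 1)
      refine ⟨min (η / p1) (l - c), lt_min (by positivity) (by linarith), fun ε hε x y h1 h2 => ?_⟩
      have h3 := h2.trans_le (min_le_left _ _)
      have h4 := h2.trans_le (min_le_right _ _)
      simp only [tr]
      split_ifs with hxy
      · rw [tr_null one_null n (x := p0 * x), mul_zero, zero_add, pow_succ, mul_comm]
        · rw [lt_div_iff₀ (by linarith)] at h3
          have hx : x ≤ max x (c + ε) := le_max_left _ _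
          have := H ε hε (p1 * max x (c + ε) - 1) (p1 * y - 1) (by nlinarith) (by nlinarith)
          have := tr_nonneg (p0 := p0) (p1 := p1) (c := c) (ε := ε) ha0 ha1 one_nonneg n
            (p1 * max x (c + ε) - 1) (p1 * y - 1)
          gcongr
        · have : min y (c - ε) < x := lt_of_le_of_lt (min_le_right _ _) (by linarith)
          gcongr
      · positivity

theorem thin_right (P : Par p0 p1 c) {κ : ℝ} (ha0 : 0 ≤ a0) (ha1 : 0 ≤ a1) (hk0 : a0 ≤ κ) (hk1 : a1 ≤ κ)
    (n : ℕ) : ∀ l : ℝ, ∃ η > 0, ∀ ε > 0, ∀ x y, ε ≤ x - l → y - l < η →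
      tr p0 p1 c ε a0 a1 one n x y ≤ κ ^ n := by
  have hp0 := P.h0
  have hp1 := P.h1
  have hκ : 0 ≤ κ := ha0.trans hk0
  induction n with
  | zero => intro l; exact ⟨1, one_pos, fun ε _ x y _ _ => by simpa [tr] using one_le x y⟩
  | succ n ih =>
    intro l
    rcases le_or_gt c l with hl | hl
    · obtain ⟨η, hη, H⟩ := ih (p1 * l - 1)
      refine ⟨η / p1, by positivity, fun ε hε x y h1 h2 => ?_⟩
      simp only [tr]
      split_ifs with hxy
      · rw [tr_null one_null n (x := p0 * x), mul_zero, zero_add, pow_succ, mul_comm]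
        · rw [max_eq_left (by linarith)]
          rw [lt_div_iff₀ (by linarith)] at h2
          have := H ε hε (p1 * x - 1) (p1 * y - 1) (by nlinarith) (by linarith)
          have := tr_nonneg (p0 := p0) (p1 := p1) (c := c) (ε := ε) ha0 ha1 one_nonneg n
            (p1 * x - 1) (p1 * y - 1)
          gcongr
        · have : min y (c - ε) < x := lt_of_le_of_lt (min_le_right _ _) (by linarith)
          gcongr
      · positivity
    · obtain ⟨η, hη, H⟩ := ih (p0 * l)
      refine ⟨min (η / p0) (c - l), lt_min (by positivity) (by linarith), fun ε hε x y h1 h2 => ?_⟩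
      have h3 := h2.trans_le (min_le_left _ _)
      have h4 := h2.trans_le (min_le_right _ _)
      simp only [tr]
      split_ifs with hxy
      · rw [tr_null one_null n (x := p1 * max x (c + ε) - 1), mul_zero, add_zero, pow_succ, mul_comm]
        · rw [lt_div_iff₀ (by linarith)] at h3
          have hx : min y (c - ε) ≤ y := min_le_left _ _
          have := H ε hε (p0 * x) (p0 * min y (c - ε)) (by nlinarith) (by nlinarith)
          have := tr_nonneg (p0 := p0) (p1 := p1) (c := c) (ε := ε) ha0 ha1 one_nonneg n
            (p0 * x) (p0 * min y (c - ε))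
          gcongr
        · have : y < max x (c + ε) := lt_of_lt_of_le (by linarith) (le_max_right _ _)
          gcongr
      · positivity

theorem thin (P : Par p0 p1 c) {κ : ℝ} (ha0 : 0 ≤ a0) (ha1 : 0 ≤ a1) (hk0 : a0 ≤ κ) (hk1 : a1 ≤ κ)
    (n : ℕ) : ∃ η > 0, ∀ ε > 0, ∀ x y, y - x < η →
      tr p0 p1 c ε a0 a1 one n x y ≤ 2 * κ ^ n := by
  have hp0 := P.h0
  have hp1 := P.h1
  have hκ : 0 ≤ κ := ha0.trans hk0
  induction n with
  | zero => exact ⟨1, one_pos, fun ε _ x y _ => by have := one_le x y; simp only [tr, pow_zero]; linarith⟩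
  | succ n ih =>
    obtain ⟨η, hη, H⟩ := ih
    obtain ⟨ηA, hA, HA⟩ := thin_left P ha0 ha1 hk0 hk1 n (p0 * c)
    obtain ⟨ηB, hB, HB⟩ := thin_right P ha0 ha1 hk0 hk1 n (p1 * c - 1)
    refine ⟨min (min (η / p0) (η / p1)) (min (ηA / p0) (ηB / p1)), by positivity, fun ε hε x y h => ?_⟩
    have k1 := h.trans_le ((min_le_left _ _).trans (min_le_left _ _))
    have k2 := h.trans_le ((min_le_left _ _).trans (min_le_right _ _))
    have k3 := h.trans_le ((min_le_right _ _).trans (min_le_left _ _))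
    have k4 := h.trans_le ((min_le_right _ _).trans (min_le_right _ _))
    rw [lt_div_iff₀ (by linarith)] at k1 k2 k3 k4
    simp only [tr]
    split_ifs with hxy
    · have nL := tr_nonneg (p0 := p0) (p1 := p1) (c := c) (ε := ε) ha0 ha1 one_nonneg n
            (p0 * x) (p0 * min y (c - ε))
      have nR := tr_nonneg (p0 := p0) (p1 := p1) (c := c) (ε := ε) ha0 ha1 one_nonneg n
            (p1 * max x (c + ε) - 1) (p1 * y - 1)
      by_cases hL : x ≤ c - ε
      · by_cases hR : c + ε ≤ y
        · have e1 := HA ε hε (p0 * x) (p0 * min y (c - ε)) (by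
            rw [min_eq_right (by linarith)]; nlinarith) (by nlinarith)
          have e2 := HB ε hε (p1 * max x (c + ε) - 1) (p1 * y - 1) (by
            rw [max_eq_right (by linarith)]; nlinarith) (by nlinarith)
          calc _ ≤ κ * κ ^ n + κ * κ ^ n := by gcongr
            _ = _ := by ring
        · rw [tr_null one_null n (x := p1 * max x (c + ε) - 1), mul_zero, add_zero]
          · have hm : min y (c - ε) ≤ y := min_le_left _ _
            have := H ε hε (p0 * x) (p0 * min y (c - ε)) (by nlinarith)
            calc _ ≤ κ * (2 * κ ^ n) := by gcongr
              _ = _ := by ring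
          · have : y < max x (c + ε) := lt_of_lt_of_le (by linarith) (le_max_right _ _)
            gcongr
      · rw [tr_null one_null n (x := p0 * x), mul_zero, zero_add]
        · have hm : x ≤ max x (c + ε) := le_max_left _ _
          have := H ε hε (p1 * max x (c + ε) - 1) (p1 * y - 1) (by nlinarith)
          calc _ ≤ κ * (2 * κ ^ n) := by gcongr
            _ = _ := by ring
        · have : min y (c - ε) < x := lt_of_le_of_lt (min_le_right _ _) (by linarith)
          gcongr
    · positivity

theorem tr_one_le (ha0 : 0 ≤ a0) (ha1 : 0 ≤ a1) (hk0 : a0 ≤ 1) (hk1 : a1 ≤ 1) (n : ℕ) :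
    ∀ x y, tr p0 p1 c ε a0 a1 one n x y ≤ 2 ^ n := by
  induction n with
  | zero => intro x y; simpa [tr] using one_le x y
  | succ n ih =>
    intro x y
    simp only [tr]
    split_ifs
    · have e1 := ih (p0 * x) (p0 * min y (c - ε))
      have e2 := ih (p1 * max x (c + ε) - 1) (p1 * y - 1)
      calc _ ≤ a0 * 2 ^ n + a1 * 2 ^ n := by gcongr
        _ ≤ 1 * 2 ^ n + 1 * 2 ^ n := by gcongr
        _ = _ := by ring
    · positivity
end

/-! ### Part 6: growth estimate -/

theorem lasota {p0 p1 c : ℝ} (P : Par p0 p1 c) : ∃ N : ℕ, 1 ≤ N ∧ ∃ θ D : ℝ, 0 ≤ θ ∧ θ < 1 ∧ 0 < D ∧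
    ∀ ε > 0, ∀ k : ℕ, ∀ x y, 0 ≤ x → y ≤ 1 / (p1 - 1) →
      tr p0 p1 c ε p0⁻¹ p1⁻¹ one (k * N) x y ≤ θ ^ k * one x y + D * len x y := by
  have hp0 := P.h0
  have hp1 := P.h1
  have ha0 : 0 ≤ p0⁻¹ := by positivity
  have ha1 : 0 ≤ p1⁻¹ := by positivity
  have hb0 : p0⁻¹ < 1 := inv_lt_one_of_one_lt₀ hp0
  have hb1 : p1⁻¹ < 1 := inv_lt_one_of_one_lt₀ hp1
  set κ := max p0⁻¹ p1⁻¹ with hκ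
  have hκ0 : 0 ≤ κ := ha0.trans (le_max_left _ _)
  have hκ1 : κ < 1 := max_lt hb0 hb1
  obtain ⟨N, hN⟩ := exists_pow_lt_of_lt_one (show (0:ℝ) < 1 / 2 by norm_num) hκ1
  have hN1 : 1 ≤ N := by
    rcases Nat.eq_zero_or_pos N with rfl | h
    · norm_num at hN
    · exact h
  obtain ⟨η, hη, H⟩ := thin P ha0 ha1 (le_max_left _ _ : p0⁻¹ ≤ κ) (le_max_right _ _) N
  set θ := 2 * κ ^ N with hθ
  have hθ0 : 0 ≤ θ := by positivity
  have hθ1 : θ < 1 := by linarith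
  have h1θ : 0 < 1 - θ := by linarith
  refine ⟨N, hN1, θ, 2 ^ N / η / (1 - θ), hθ0, hθ1, by positivity, fun ε hε k => ?_⟩
  set D := 2 ^ N / η / (1 - θ) with hD
  have hDe : θ * D + 2 ^ N / η = D := by rw [hD]; field_simp; ring
  have step : ∀ x y, tr p0 p1 c ε p0⁻¹ p1⁻¹ one N x y ≤ θ * one x y + (2 ^ N / η) * len x y := by
    intro x y
    rcases lt_or_ge y x with h | h
    · rw [tr_null one_null N h, one_null _ _ h, len_null _ _ h]; simp
    · have o : one x y = 1 := by unfold one; rw [if_pos h]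
      have l : len x y = y - x := max_eq_left (by linarith)
      rw [o, l]
      rcases lt_or_ge (y - x) η with h' | h'
      · have := H ε hε x y h'
        have : 0 ≤ 2 ^ N / η * (y - x) := by have : 0 ≤ y - x := by linarith
                                             positivity
        linarith
      · have e := tr_one_le (p0 := p0) (p1 := p1) (c := c) (ε := ε) ha0 ha1 hb0.le hb1.le N x y
        have : (2:ℝ) ^ N = 2 ^ N / η * η := by field_simp
        have : 2 ^ N / η * η ≤ 2 ^ N / η * (y - x) := by gcongr
        linarith
  induction k with
  | zero =>
    intro x y _ _
    have := len_nonneg x y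
    have hD0 : 0 ≤ D := by positivity
    simp only [zero_mul, tr, pow_zero, one_mul]
    nlinarith
  | succ k ih =>
    intro x y hx hy
    rw [Nat.succ_mul, tr_add]
    have e1 := tr_mono P hε ha0 ha1 (fun x y _ _ => step x y) (k * N) x y hx hy
    rw [tr_lin] at e1
    have e2 := ih x y hx hy
    have e3 := tr_len_le P hε (k * N) x y
    refine e1.trans ?_
    calc _ ≤ θ * (θ ^ k * one x y + D * len x y) + 2 ^ N / η * len x y := by gcongr
      _ = θ ^ (k + 1) * one x y + (θ * D + 2 ^ N / η) * len x y := by ring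
      _ = _ := by rw [hDe]

theorem growth {p0 p1 c t : ℝ} (P : Par p0 p1 c) (ht1 : t < 1) :
    ∃ η > 0, η ≤ 1 / (p1 - 1) ∧ ∃ n : ℕ, 1 ≤ n ∧ ∃ ε > 0, ∀ r0 r1 : ℝ, 1 < r0 → 1 < r1 →
      r0 ≤ p0 ^ t → r1 ≤ p1 ^ t → ∀ x y, 0 ≤ x → y ≤ 1 / (p1 - 1) →
        2 * lng η x y ≤ tr p0 p1 c ε r0⁻¹ r1⁻¹ (lng η) n x y := by
  have hp0 := P.h0
  have hp1 := P.h1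
  have ha0 : 0 ≤ p0⁻¹ := by positivity
  have ha1 : 0 ≤ p1⁻¹ := by positivity
  obtain ⟨N, hN1, θ, D, hθ0, hθ1, hD, HL⟩ := lasota P
  have hm := mpos hp1
  set m := 1 / (p1 - 1) with hmd
  set η := min m (1 / (8 * D)) with hηd
  have hη : 0 < η := lt_min hm (by positivity)
  have hηD : η * D ≤ 1 / 8 := by
    calc η * D ≤ 1 / (8 * D) * D := by gcongr; exact min_le_right _ _
      _ = 1 / 8 := by field_simp
  set ω := min p0 p1 ^ (1 - t) with hω
  have hmin : 1 < min p0 p1 := lt_min hp0 hp1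
  have hω1 : 1 < ω := Real.one_lt_rpow hmin (by linarith)
  have ev1 : ∀ᶠ k : ℕ in atTop, θ ^ k ≤ 1 / 8 :=
    (tendsto_pow_atTop_nhds_zero_of_lt_one hθ0 hθ1).eventually_le_const (by norm_num)
  have ev2 : ∀ᶠ k : ℕ in atTop, 2 / (η / (2 * m)) ≤ ω ^ k :=
    (tendsto_pow_atTop_atTop_of_one_lt hω1).eventually_ge_atTop _
  obtain ⟨k, hk1, hk2, hk3⟩ := (ev1.and (ev2.and (eventually_ge_atTop 1))).exists
  have hkN : k ≤ k * N := Nat.le_mul_of_pos_right _ hN1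
  have hωn : 2 ≤ ω ^ (k * N) * (η / (2 * m)) := by
    rw [div_le_iff₀ (by positivity)] at hk2
    refine hk2.trans ?_
    have := pow_le_pow_right₀ hω1.le hkN
    gcongr
  refine ⟨η, hη, min_le_left _ _, k * N, hk3.trans hkN, η / 4 / 2 ^ (k * N + 1), by positivity, ?_⟩
  set n := k * N with hn
  set ε := η / 4 / 2 ^ (n + 1) with hεd
  have hε : 0 < ε := by positivity
  have hεn : 2 * ε * (2 ^ n - 1) ≤ η / 4 := by
    have : η / 4 = ε * 2 ^ (n + 1) := by rw [hεd]; field_simp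
    rw [this, pow_succ]; nlinarith
  intro r0 r1 hr0 hr1 hr0' hr1' x y hx hy
  have wt : ∀ p r : ℝ, min p0 p1 ≤ p → 1 < p → 1 < r → r ≤ p ^ t → ω * p⁻¹ ≤ r⁻¹ := by
    intro p r hmp hp hr hrp
    have e1 : ω ≤ p ^ (1 - t) := Real.rpow_le_rpow (by linarith) hmp (by linarith)
    have e2 : p ^ (1 - t) * p⁻¹ = (p ^ t)⁻¹ := by
      rw [← Real.rpow_neg_one p, ← Real.rpow_add (by linarith), ← Real.rpow_neg (by linarith)]
      congr 1; ring
    calc ω * p⁻¹ ≤ p ^ (1 - t) * p⁻¹ := by gcongr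
      _ = _ := e2
      _ ≤ r⁻¹ := by gcongr
  by_cases hl : η ≤ y - x
  · have l1 : lng η x y = 1 := by unfold lng; rw [if_pos hl]
    have ll : len x y = y - x := max_eq_left (by linarith)
    have ol : one x y = 1 := by unfold one; rw [if_pos (by linarith)]
    rw [l1, mul_one]
    have w := tr_weight (p0 := p0) (p1 := p1) (c := c) (ε := ε) ha0 ha1 (by linarith : (0:ℝ) ≤ ω)
      (wt p0 r0 (min_le_left _ _) hp0 hr0 hr0') (wt p1 r1 (min_le_right _ _) hp1 hr1 hr1')
      (lng_nonneg η) n x y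
    refine le_trans ?_ w
    refine hωn.trans ?_
    have g1 := tr_len_ge P hε n x y
    have g2 := tr_mono P hε ha0 ha1 (F := len) (G := fun x y => η * one x y + m * lng η x y) (by
      intro x y hx hy
      have o0 := one_nonneg x y
      unfold len lng
      split_ifs with h
      · have : max (y - x) 0 ≤ m := max_le (by linarith) hm.le
        have : 0 ≤ η * one x y := by positivity
        linarith
      · rcases le_or_gt x y with h' | h'
        · have ol : one x y = 1 := by unfold one; rw [if_pos (by linarith)]
          rw [ol, max_eq_left (by linarith)]; push Not at h; linarith
        · rw [max_eq_right (by linarith)]; positivity) n x y hx hy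
    rw [tr_lin] at g2
    have g3 := HL ε hε k x y hx hy
    rw [← hn, ol, ll, mul_one] at g3
    rw [ll] at g1
    have g4 : η * tr p0 p1 c ε p0⁻¹ p1⁻¹ one n x y ≤ η * (1 / 8) + (1 / 8) * (y - x) := by
      have := mul_le_mul_of_nonneg_left g3 hη.le
      have h1 := mul_le_mul_of_nonneg_left hk1 hη.le
      have h2 := mul_le_mul_of_nonneg_right hηD (by linarith : 0 ≤ y - x)
      nlinarith
    have g5 : η / 2 ≤ m * tr p0 p1 c ε p0⁻¹ p1⁻¹ (lng η) n x y := by linarith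
    have : η / (2 * m) ≤ tr p0 p1 c ε p0⁻¹ p1⁻¹ (lng η) n x y := by
      rw [div_le_iff₀ (by positivity)]; linarith
    gcongr
  · have l1 : lng η x y = 0 := by unfold lng; rw [if_neg hl]
    rw [l1, mul_zero]
    exact tr_nonneg (by positivity) (by positivity) (lng_nonneg η) n x y

/-! codes in intervals -/

def cns (d : Bool) (i : ℕ → Bool) : ℕ → Bool
  | 0 => d
  | n + 1 => i n

theorem cns_shift (d : Bool) (i : ℕ → Bool) (n : ℕ) : shiftTail (cns d i) (n + 1) = shiftTail i n := by
  funext k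
  show cns d i (n + 1 + k) = i (n + k)
  rw [show n + 1 + k = (n + k) + 1 by omega]; rfl

theorem cns_shift1 (d : Bool) (i : ℕ → Bool) : shiftTail (cns d i) 1 = i := by
  rw [cns_shift d i 0, shift_zero]

theorem piE_cns0 {r0 r1 : ℝ} (h0 : 1 < r0) (h1 : 1 < r1) (i : ℕ → Bool) :
    piE r0 r1 (cns false i) = piE r0 r1 i / r0 := by
  rw [piE_rec0 h0 h1 rfl, cns_shift1]

theorem piE_cns1 {r0 r1 : ℝ} (h0 : 1 < r0) (h1 : 1 < r1) (i : ℕ → Bool) :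
    piE r0 r1 (cns true i) = (1 + piE r0 r1 i) / r1 := by
  rw [piE_rec1 h0 h1 rfl, cns_shift1]

def XK (p0 p1 α β : ℝ) (k : ℕ) (x y : ℝ) : Set (ℕ → Bool) :=
  {i | (∀ n < k, (i n = false → piE p0 p1 (shiftTail i n) ≤ α) ∧
    (i n = true → β ≤ piE p0 p1 (shiftTail i n))) ∧ x ≤ piE p0 p1 i ∧ piE p0 p1 i ≤ y}

def XI (p0 p1 α β : ℝ) (x y : ℝ) : Set (ℕ → Bool) :=
  {i | i ∈ XS p0 p1 α β ∧ x ≤ piE p0 p1 i ∧ piE p0 p1 i ≤ y}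

theorem bnd0 {p0 p1 α x y z : ℝ} (h0 : 1 < p0) (a : p0 * x ≤ z) (b : z ≤ p0 * min y α) :
    x ≤ z / p0 ∧ z / p0 ≤ y ∧ z / p0 ≤ α := by
  have hp : 0 < p0 := by linarith
  have h1 : z / p0 ≤ min y α := by rw [div_le_iff₀ hp]; linarith
  exact ⟨by rw [le_div_iff₀ hp]; linarith, h1.trans (min_le_left _ _), h1.trans (min_le_right _ _)⟩

theorem bnd1 {p1 β x y z : ℝ} (h1 : 1 < p1) (a : p1 * max x β - 1 ≤ z) (b : z ≤ p1 * y - 1) :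
    x ≤ (1 + z) / p1 ∧ (1 + z) / p1 ≤ y ∧ β ≤ (1 + z) / p1 := by
  have hp : 0 < p1 := by linarith
  have h : max x β ≤ (1 + z) / p1 := by rw [le_div_iff₀ hp]; linarith
  exact ⟨(le_max_left _ _).trans h, by rw [div_le_iff₀ hp]; linarith, (le_max_right _ _).trans h⟩

theorem XK_cns0 {p0 p1 α β x y : ℝ} (h0 : 1 < p0) (h1 : 1 < p1) {k : ℕ} {i : ℕ → Bool}
    (h : i ∈ XK p0 p1 α β k (p0 * x) (p0 * min y α)) : cns false i ∈ XK p0 p1 α β (k + 1) x y := by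
  obtain ⟨hk, ha, hb⟩ := h
  obtain ⟨e1, e2, e3⟩ := bnd0 (p1 := p1) h0 ha hb
  refine ⟨fun n hn => ?_, by rwa [piE_cns0 h0 h1], by rwa [piE_cns0 h0 h1]⟩
  cases n with
  | zero => rw [shift_zero, piE_cns0 h0 h1]; exact ⟨fun _ => e3, fun h => by simp [cns] at h⟩
  | succ n => rw [cns_shift]; exact hk n (by omega)

theorem XK_cns1 {p0 p1 α β x y : ℝ} (h0 : 1 < p0) (h1 : 1 < p1) {k : ℕ} {i : ℕ → Bool}
    (h : i ∈ XK p0 p1 α β k (p1 * max x β - 1) (p1 * y - 1)) : cns true i ∈ XK p0 p1 α β (k + 1) x y := by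
  obtain ⟨hk, ha, hb⟩ := h
  obtain ⟨e1, e2, e3⟩ := bnd1 h1 ha hb
  refine ⟨fun n hn => ?_, by rwa [piE_cns1 h0 h1], by rwa [piE_cns1 h0 h1]⟩
  cases n with
  | zero => rw [shift_zero, piE_cns1 h0 h1]; exact ⟨fun h => by simp [cns] at h, fun _ => e3⟩
  | succ n => rw [cns_shift]; exact hk n (by omega)

theorem XI_iff {p0 p1 α β x y : ℝ} {i : ℕ → Bool} : i ∈ XI p0 p1 α β x y ↔ ∀ k, i ∈ XK p0 p1 α β k x y :=
  ⟨fun h _ => ⟨fun n _ => h.1 n, h.2⟩, fun h => ⟨fun n => (h (n + 1)).1 n (by omega), (h 0).2⟩⟩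

theorem XI_cns0 {p0 p1 α β x y : ℝ} (h0 : 1 < p0) (h1 : 1 < p1) {i : ℕ → Bool}
    (h : i ∈ XI p0 p1 α β (p0 * x) (p0 * min y α)) : cns false i ∈ XI p0 p1 α β x y := by
  refine ⟨fun n => (XK_cns0 h0 h1 (XI_iff.1 h n)).1 n (by omega), (XK_cns0 h0 h1 (XI_iff.1 h 0)).2⟩

theorem XI_cns1 {p0 p1 α β x y : ℝ} (h0 : 1 < p0) (h1 : 1 < p1) {i : ℕ → Bool}
    (h : i ∈ XI p0 p1 α β (p1 * max x β - 1) (p1 * y - 1)) : cns true i ∈ XI p0 p1 α β x y := by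
  refine ⟨fun n => (XK_cns1 h0 h1 (XI_iff.1 h n)).1 n (by omega), (XK_cns1 h0 h1 (XI_iff.1 h 0)).2⟩

theorem XK_closed {p0 p1 α β x y : ℝ} (h0 : 1 < p0) (h1 : 1 < p1) (k : ℕ) :
    IsClosed (XK p0 p1 α β k x y) := by
  have hc := piE_cont1 h0 h1
  have e : XK p0 p1 α β k x y = (⋂ n : ℕ, ⋂ _ : n < k,
      ({i | i n = false → piE p0 p1 (shiftTail i n) ≤ α} ∩
       {i | i n = true → β ≤ piE p0 p1 (shiftTail i n)})) ∩
      ({i | x ≤ piE p0 p1 i} ∩ {i | piE p0 p1 i ≤ y}) := by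
    ext i
    simp [XK]
  rw [e]
  refine IsClosed.inter (isClosed_iInter fun n => isClosed_iInter fun _ => ?_)
    ((isClosed_le continuous_const hc).inter (isClosed_le hc continuous_const))
  have hp : Continuous fun i : ℕ → Bool => piE p0 p1 (shiftTail i n) := hc.comp (shift_cont continuous_id n)
  refine IsClosed.inter ?_ ?_
  · exact isClosed_imp (closed_digit continuous_id n false).isOpen (isClosed_le hp continuous_const)
  · exact isClosed_imp (closed_digit continuous_id n true).isOpen (isClosed_le continuous_const hp)

theorem XI_nonempty {p0 p1 α β x y : ℝ} (h0 : 1 < p0) (h1 : 1 < p1)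
    (h : ∀ k, ∃ K ≥ k, (XK p0 p1 α β K x y).Nonempty) : (XI p0 p1 α β x y).Nonempty := by
  have mono : ∀ k K, k ≤ K → XK p0 p1 α β K x y ⊆ XK p0 p1 α β k x y :=
    fun k K hk i hi => ⟨fun n hn => hi.1 n (by omega), hi.2⟩
  obtain ⟨i, hi⟩ := IsCompact.nonempty_iInter_of_sequence_nonempty_isCompact_isClosed
    (fun k => XK p0 p1 α β k x y) (fun k => mono _ _ (Nat.le_succ k))
    (fun k => by obtain ⟨K, hK, hne⟩ := h k; exact hne.mono (mono _ _ hK))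
    (XK_closed h0 h1 0).isCompact (fun k => XK_closed h0 h1 k)
  exact ⟨i, XI_iff.2 fun k => Set.mem_iInter.1 hi k⟩

theorem no_gap {p0 p1 c t : ℝ} (P : Par p0 p1 c) (ht1 : t < 1) :
    ∃ ε > 0, ∀ r0 r1 : ℝ, 1 < r0 → 1 < r1 → r0 ≤ p0 ^ t → r1 ≤ p1 ^ t →
      ¬ ∃ g > 0, ∀ i ∈ XS p0 p1 (c - ε) (c + ε), ∀ j ∈ XS p0 p1 (c - ε) (c + ε),
        i 0 = false → j 0 = true → piE r0 r1 i + g ≤ piE r0 r1 j := by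
  obtain ⟨η, hη, hηm, n, hn, ε, hε, HG⟩ := growth P ht1
  refine ⟨ε, hε, fun r0 r1 k0 k1 hr0 hr1 ⟨g, hg, gap⟩ => ?_⟩
  have hp0 := P.h0
  have hp1 := P.h1
  have G := HG r0 r1 k0 k1 hr0 hr1
  have b0 : 0 < r0⁻¹ := by positivity
  have b1 : 0 < r1⁻¹ := by positivity
  have b0' : r0⁻¹ ≤ 1 := inv_le_one_of_one_le₀ k0.le
  have b1' : r1⁻¹ ≤ 1 := inv_le_one_of_one_le₀ k1.le
  set m := 1 / (p1 - 1) with hm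
  have key : ∀ (F : ℝ → ℝ → ℝ) (Q : ℕ → ℝ → ℝ → Prop) (k : ℕ),
      (∀ x y, 0 ≤ x → y ≤ m → 0 < F x y → (XK p0 p1 (c - ε) (c + ε) k x y).Nonempty) → ∀ l,
      ∀ x y, 0 ≤ x → y ≤ m → 0 < tr p0 p1 c ε r0⁻¹ r1⁻¹ F l x y →
        (XK p0 p1 (c - ε) (c + ε) (k + l) x y).Nonempty := by
    intro F _ k hk l
    induction l with
    | zero => exact hk
    | succ l ih =>
      intro x y hx hy hpos
      simp only [tr] at hpos
      split_ifs at hpos with hxy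
      · obtain ⟨l1, l2⟩ := P.rangeL hε y hx
        obtain ⟨r1', r2⟩ := P.rangeR hε x hy
        by_cases hL : 0 < tr p0 p1 c ε r0⁻¹ r1⁻¹ F l (p0 * x) (p0 * min y (c - ε))
        · obtain ⟨i, hi⟩ := ih _ _ l1 l2 hL
          exact ⟨_, XK_cns0 hp0 hp1 hi⟩
        · by_cases hR : 0 < tr p0 p1 c ε r0⁻¹ r1⁻¹ F l (p1 * max x (c + ε) - 1) (p1 * y - 1)
          · obtain ⟨i, hi⟩ := ih _ _ r1' r2 hR
            exact ⟨_, XK_cns1 hp0 hp1 hi⟩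
          · push Not at hL hR
            nlinarith
      · exact absurd hpos (lt_irrefl _)
  have lpos : ∀ k : ℕ, ∀ x y, 0 ≤ x → y ≤ m → 0 < lng η x y →
      (XK p0 p1 (c - ε) (c + ε) (k * n) x y).Nonempty := by
    intro k
    induction k with
    | zero =>
      intro x y hx hy hl
      unfold lng at hl
      split_ifs at hl with h
      · obtain ⟨i, hi, _⟩ := itin hp0 hp1 P.hc1 P.hc0 hx (show x ≤ 1 / (p1 - 1) by linarith)
        exact ⟨i, fun n hn => by omega, by rw [hi], by rw [hi]; linarith⟩
      · exact absurd hl (lt_irrefl _)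
    | succ k ih =>
      intro x y hx hy hl
      rw [Nat.succ_mul]
      refine key (lng η) (fun _ _ _ => True) (k * n) ih n x y hx hy ?_
      have := G x y hx hy
      linarith
  have ne : ∀ x y, 0 ≤ x → y ≤ m → 0 < lng η x y → (XI p0 p1 (c - ε) (c + ε) x y).Nonempty :=
    fun x y hx hy hl => XI_nonempty hp0 hp1 fun k =>
      ⟨k * n, Nat.le_mul_of_pos_right _ hn, lpos k x y hx hy hl⟩
  let Ach : (ℝ → ℝ → ℝ) → Prop := fun F => ∀ x y, 0 ≤ x → y ≤ m → 0 < F x y →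
    ∃ u ∈ XI p0 p1 (c - ε) (c + ε) x y, ∃ v ∈ XI p0 p1 (c - ε) (c + ε) x y,
      F x y ≤ piE r0 r1 u - piE r0 r1 v + g
  have ach_tr : ∀ F, Ach F → ∀ l, Ach (tr p0 p1 c ε r0⁻¹ r1⁻¹ F l) := by
    intro F hF l
    induction l with
    | zero => exact hF
    | succ l ih =>
      intro x y hx hy hpos
      simp only [tr] at hpos ⊢
      split_ifs at hpos ⊢ with hxy
      · obtain ⟨l1, l2⟩ := P.rangeL hε y hx
        obtain ⟨r1', r2⟩ := P.rangeR hε x hy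
        have sL := ih _ _ l1 l2
        have sR := ih _ _ r1' r2
        set A := tr p0 p1 c ε r0⁻¹ r1⁻¹ F l (p0 * x) (p0 * min y (c - ε))
        set B := tr p0 p1 c ε r0⁻¹ r1⁻¹ F l (p1 * max x (c + ε) - 1) (p1 * y - 1)
        by_cases hL : 0 < A
        · obtain ⟨u1, hu1, v1, hv1, h1⟩ := sL hL
          have h1' := mul_le_mul_of_nonneg_left h1 b0.le
          have g0 := mul_le_mul_of_nonneg_right b0' hg.le
          by_cases hR : 0 < B
          · obtain ⟨u2, hu2, v2, hv2, h2⟩ := sR hR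
            have h2' := mul_le_mul_of_nonneg_left h2 b1.le
            have g1 := mul_le_mul_of_nonneg_right b1' hg.le
            refine ⟨_, XI_cns1 hp0 hp1 hu2, _, XI_cns0 hp0 hp1 hv1, ?_⟩
            have gp := gap _ (XI_cns0 hp0 hp1 hu1).1 _ (XI_cns1 hp0 hp1 hv2).1 rfl rfl
            rw [piE_cns0 k0 k1, piE_cns1 k0 k1, div_eq_mul_inv, div_eq_mul_inv] at gp
            rw [piE_cns0 k0 k1, piE_cns1 k0 k1, div_eq_mul_inv, div_eq_mul_inv]
            nlinarith
          · push Not at hR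
            refine ⟨_, XI_cns0 hp0 hp1 hu1, _, XI_cns0 hp0 hp1 hv1, ?_⟩
            have : r1⁻¹ * B ≤ 0 := mul_nonpos_of_nonneg_of_nonpos b1.le hR
            rw [piE_cns0 k0 k1, piE_cns0 k0 k1, div_eq_mul_inv, div_eq_mul_inv]
            nlinarith
        · push Not at hL
          have hA : r0⁻¹ * A ≤ 0 := mul_nonpos_of_nonneg_of_nonpos b0.le hL
          have hR : 0 < B := by
            by_contra hR
            push Not at hR
            have : r1⁻¹ * B ≤ 0 := mul_nonpos_of_nonneg_of_nonpos b1.le hR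
            linarith
          obtain ⟨u2, hu2, v2, hv2, h2⟩ := sR hR
          have h2' := mul_le_mul_of_nonneg_left h2 b1.le
          have g1 := mul_le_mul_of_nonneg_right b1' hg.le
          refine ⟨_, XI_cns1 hp0 hp1 hu2, _, XI_cns1 hp0 hp1 hv2, ?_⟩
          rw [piE_cns1 k0 k1, piE_cns1 k0 k1, div_eq_mul_inv, div_eq_mul_inv]
          nlinarith
      · exact absurd hpos (lt_irrefl _)
  have ach : ∀ K : ℕ, Ach (fun x y => (2 ^ K * g) * lng η x y) := by
    intro K
    induction K with
    | zero =>
      intro x y hx hy hpos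
      simp only [pow_zero, one_mul] at hpos ⊢
      obtain ⟨u, hu⟩ := ne x y hx hy (pos_of_mul_pos_right hpos hg.le)
      refine ⟨u, hu, u, hu, ?_⟩
      have : lng η x y ≤ 1 := by unfold lng; split_ifs <;> norm_num
      nlinarith
    | succ K ih =>
      intro x y hx hy hpos
      have h := ach_tr _ ih n x y hx hy
      rw [tr_smul] at h
      have g2 := G x y hx hy
      have hC : 0 < (2:ℝ) ^ K * g := by positivity
      have g3 := mul_le_mul_of_nonneg_left g2 hC.le
      have e : 2 ^ (K + 1) * g * lng η x y = 2 ^ K * g * (2 * lng η x y) := by ring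
      simp only [e] at hpos ⊢
      obtain ⟨u, hu, v, hv, h'⟩ := h (hpos.trans_le g3)
      exact ⟨u, hu, v, hv, g3.trans h'⟩
  have l0 : lng η 0 m = 1 := by unfold lng; rw [if_pos (by linarith)]
  have lim : Tendsto (fun K : ℕ => (2:ℝ) ^ K) atTop atTop :=
    tendsto_pow_atTop_atTop_of_one_lt (by norm_num)
  obtain ⟨K, hK⟩ := (lim.eventually_gt_atTop ((1 / (r1 - 1) + g) / g)).exists
  rw [div_lt_iff₀ hg] at hK
  obtain ⟨u, _, v, _, h⟩ := ach K 0 m le_rfl le_rfl (by simp only [l0]; positivity)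
  simp only [l0, mul_one] at h
  have := piE_le k0 k1 u
  have := piE_nonneg k0 k1 v
  linarith

/-! ### Part 7: assembly -/

theorem ng_open {q0 q1 s s' : ℝ} (h0 : 1 < q0) (h1 : 1 < q1) (hs' : 0 < s') (hss : s' < s)
    (h : NG q0 q1 (q0 ^ s) (q1 ^ s)) :
    ∀ᶠ q : ℝ × ℝ in 𝓝 (q0, q1), NG q.1 q.2 (q.1 ^ s') (q.2 ^ s') := by
  obtain ⟨u, hu, a, ha, b, hb, c, ha0, hb0, hac, hbc, all0, all1⟩ := crit h0 h1 (hs'.trans hss) h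
  have hupos : 0 < u := by linarith
  have S : Setup q0 q1 (q0 ^ u) (q1 ^ u) c a b :=
    ⟨h0, h1, Real.one_lt_rpow h0 hupos, Real.one_lt_rpow h1 hupos, ha, hb, ha0, hb0, hac, hbc, all0, all1⟩
  have P : Par (q0 ^ u) (q1 ^ u) c := ⟨S.hp0, S.hp1, S.c_ge, S.c_le⟩
  obtain ⟨t, ht0, ht1⟩ := exists_between (show s' / u < 1 by rw [div_lt_one hupos]; linarith)
  rw [div_lt_iff₀ hupos] at ht0
  obtain ⟨ε, hε, H⟩ := no_gap P ht1
  have e1 : ∀ᶠ q : ℝ × ℝ in 𝓝 (q0, q1), 1 < q.1 :=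
    continuousAt_fst.eventually_const_lt h0
  have e2 : ∀ᶠ q : ℝ × ℝ in 𝓝 (q0, q1), 1 < q.2 :=
    continuousAt_snd.eventually_const_lt h1
  have e3 : ∀ᶠ q : ℝ × ℝ in 𝓝 (q0, q1), q.1 ^ s' < (q0 ^ u) ^ t := by
    refine Tendsto.eventually_lt_const ?_
      ((continuousAt_fst (p := (q0, q1))).rpow_const (Or.inr hs'.le))
    rw [← Real.rpow_mul (by linarith)]
    exact Real.rpow_lt_rpow_of_exponent_lt h0 (by linarith)
  have e4 : ∀ᶠ q : ℝ × ℝ in 𝓝 (q0, q1), q.2 ^ s' < (q1 ^ u) ^ t := by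
    refine Tendsto.eventually_lt_const ?_
      ((continuousAt_snd (p := (q0, q1))).rpow_const (Or.inr hs'.le))
    rw [← Real.rpow_mul (by linarith)]
    exact Real.rpow_lt_rpow_of_exponent_lt h1 (by linarith)
  filter_upwards [e1, e2, e3, e4, SS_sub_V S hε] with q f1 f2 f3 f4 f5
  by_contra hn
  have k0 := Real.one_lt_rpow f1 hs'
  have k1 := Real.one_lt_rpow f2 hs'
  obtain ⟨g, hg, gap⟩ := unif_gap f1 f2 k0 k1 hn
  exact H _ _ k0 k1 f3.le f4.le ⟨g, hg, fun i hi j hj => gap i (f5 hi) j (f5 hj)⟩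

theorem main {q0 q1 : ℝ} (h0 : 1 < q0) (h1 : 1 < q1) :
    ContinuousAt (fun p : ℝ × ℝ => dimH (univoque p.1 p.2)) (q0, q1) := by
  have e1 : ∀ᶠ q : ℝ × ℝ in 𝓝 (q0, q1), 1 < q.1 :=
    continuousAt_fst.eventually_const_lt h0
  have e2 : ∀ᶠ q : ℝ × ℝ in 𝓝 (q0, q1), 1 < q.2 :=
    continuousAt_snd.eventually_const_lt h1
  refine tendsto_order.2 ⟨fun a ha => ?_, fun b hb => ?_⟩
  · obtain ⟨s', hs1, hs2⟩ := ENNReal.lt_iff_exists_nnreal_btwn.1 ha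
    obtain ⟨s, hs3, hs4⟩ := ENNReal.lt_iff_exists_nnreal_btwn.1 hs2
    have hs'0 : 0 < (s' : ℝ) := by
      have : (0 : ENNReal) < s' := lt_of_le_of_lt zero_le hs1
      exact_mod_cast this
    have hss : (s' : ℝ) < s := by exact_mod_cast hs3
    have hng : NG q0 q1 (q0 ^ (s : ℝ)) (q1 ^ (s : ℝ)) := by
      by_contra hn
      have := gap_dim h0 h1 (hs'0.trans hss) hn
      rw [ENNReal.ofReal_coe_nnreal] at this
      exact absurd hs4 (not_lt.2 this)
    filter_upwards [e1, e2, ng_open h0 h1 hs'0 hss hng] with q f1 f2 f3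
    have := ng_dim f1 f2 hs'0 f3
    rw [ENNReal.ofReal_coe_nnreal] at this
    exact hs1.trans_le this
  · obtain ⟨s, hs1, hs2⟩ := ENNReal.lt_iff_exists_nnreal_btwn.1 hb
    have hs0 : 0 < (s : ℝ) := by
      have : (0 : ENNReal) < s := lt_of_le_of_lt zero_le hs1
      exact_mod_cast this
    have hng : ¬ NG q0 q1 (q0 ^ (s : ℝ)) (q1 ^ (s : ℝ)) := by
      intro hn
      have := ng_dim h0 h1 hs0 hn
      rw [ENNReal.ofReal_coe_nnreal] at this
      exact absurd hs1 (not_lt.2 this)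
    filter_upwards [e1, e2, gap_open h0 h1 hs0 hng] with q f1 f2 f3
    have := gap_dim f1 f2 hs0 f3
    rw [ENNReal.ofReal_coe_nnreal] at this
    exact this.trans_lt hs2

end DB

/-- Theorem 4: the map `(q₀,q₁) ↦ dim_H 𝒰_{q₀,q₁}` is continuous on `(1,∞) × (1,∞)`. -/
theorem stmt8 :
    ContinuousOn (fun p : ℝ × ℝ => dimH (univoque p.1 p.2))
      (Set.Ioi (1 : ℝ) ×ˢ Set.Ioi (1 : ℝ)) :=
  fun p hp => (DB.main hp.1 hp.2).continuousWithinAt
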